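/- Let Q₂ = Sp(3)/H′ be the left coset space of Sp(3) by the closed subgroup H′ = {diag(q₁, z, q₂) : q₁, q₂ ∈ Sp(1), z ∈ S¹}, where S¹ ⊆ Sp(1) is the circle of unit complex numbers inside the unit quaternions, equipped with the quotient topology. Then π₂(Q₂) is isomorphic to ℤ and π₄(Q₂) is isomorphic to ℤ. -/

import Mathlib

open scoped Quaternion Topology

noncomputable section

/-- `Sp 3`, the group of `3 × 3` quaternionic matrices `g` with `g* g = 1`, topologized as a
subspace of the `3 × 3` quaternionic matrices. -/
abbrev Sp3 : Type := ↥(unitary (Matrix (Fin 3) (Fin 3) ℍ[ℝ]))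

/-- The left-coset relation on `Sp 3` induced by the subgroup
`H′ = {diag(q₁, z, q₂) : q₁, q₂ ∈ Sp(1), z ∈ S¹}`, where `S¹ ⊆ Sp(1)` consists of the unit
quaternions with vanishing `j` and `k` parts (the unit complex numbers):
`g ∼ g'` iff `g' = g h` for some `h ∈ H′`. -/
def H'Rel (g g' : Sp3) : Prop :=
  ∃ h : Sp3, (∃ q₁ q₂ z : ℍ[ℝ], ‖q₁‖ = 1 ∧ ‖q₂‖ = 1 ∧
      ‖z‖ = 1 ∧ z.imJ = 0 ∧ z.imK = 0 ∧
    h.val = Matrix.diagonal ![q₁, z, q₂]) ∧ g' = g * h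

/-- `Q₂ = Sp(3)/Sp(1)²S¹`, with the quotient topology. -/
abbrev Q₂ : Type := Quot H'Rel

section PartA

open unitInterval Topology.Homotopy

variable {N M X Y Z : Type} [TopologicalSpace X] [TopologicalSpace Y] [TopologicalSpace Z]

theorem loop_bd {x : X} (f : Ω^ N X x) (y : I^N) (hy : y ∈ Cube.boundary N) : f y = x :=
  GenLoop.boundary f y hy

theorem hom_of {x : X} {f g : Ω^ N X x} (H : (I^N) → I → X)
    (hc : Continuous fun p : (I^N) × I => H p.1 p.2)
    (h0 : ∀ y, H y 0 = f y) (h1 : ∀ y, H y 1 = g y)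
    (hb : ∀ y ∈ Cube.boundary N, ∀ t, H y t = x) : GenLoop.Homotopic f g := by
  refine ⟨{ toFun := fun p => H p.2 p.1, continuous_toFun := ?_, map_zero_left := ?_,
            map_one_left := ?_, prop' := ?_ }⟩
  · exact hc.comp (continuous_snd.prodMk continuous_fst)
  · intro y; exact h0 y
  · intro y; exact h1 y
  · intro t y hy
    change H y t = f y
    rw [hb y hy t, loop_bd f y hy]

theorem of_hom {x : X} {f g : Ω^ N X x} (h : GenLoop.Homotopic f g) :
    ∃ H : (I^N) → I → X, (Continuous fun p : (I^N) × I => H p.1 p.2) ∧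
      (∀ y, H y 0 = f y) ∧ (∀ y, H y 1 = g y) ∧
      (∀ y ∈ Cube.boundary N, ∀ t, H y t = x) := by
  obtain ⟨H⟩ := h
  refine ⟨fun y t => H (t, y), ?_, ?_, ?_, ?_⟩
  · exact (map_continuous H).comp (continuous_snd.prodMk continuous_fst)
  · intro y; exact H.apply_zero y
  · intro y; exact H.apply_one y
  · intro y hy t
    have := H.eq_fst t hy
    exact this.trans (loop_bd f y hy)

/-- make a GenLoop from a function -/
def mkLoop {x : X} (f : (I^N) → X) (hc : Continuous f) (hb : ∀ y ∈ Cube.boundary N, f y = x) :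
    Ω^ N X x := ⟨⟨f, hc⟩, hb⟩

@[simp] theorem mkLoop_apply {x : X} (f : (I^N) → X) (hc : Continuous f)
    (hb : ∀ y ∈ Cube.boundary N, f y = x) (y : I^N) : mkLoop f hc hb y = f y := rfl

theorem loop_cont {x : X} (f : Ω^ N X x) : Continuous f := f.1.continuous

theorem transAt_apply [DecidableEq N] {x : X} (i : N) (f g : Ω^ N X x) (t : I^N) :
    GenLoop.transAt i f g t = if (t i : ℝ) ≤ 1 / 2
      then f (Function.update t i <| Set.projIcc 0 1 zero_le_one (2 * t i))
      else g (Function.update t i <| Set.projIcc 0 1 zero_le_one (2 * t i - 1)) := rfl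

/-- push forward of a loop -/
def mapLoop {x : X} {y : Y} (φ : X → Y) (hφ : Continuous φ) (hx : φ x = y) (f : Ω^ N X x) :
    Ω^ N Y y :=
  mkLoop (fun s => φ (f s)) (hφ.comp (loop_cont f)) (fun s hs => by rw [loop_bd f s hs, hx])

@[simp] theorem mapLoop_apply {x : X} {y : Y} (φ : X → Y) (hφ : Continuous φ) (hx : φ x = y)
    (f : Ω^ N X x) (s : I^N) : mapLoop φ hφ hx f s = φ (f s) := rfl

theorem mapLoop_hom {x : X} {y : Y} (φ : X → Y) (hφ : Continuous φ) (hx : φ x = y)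
    {f g : Ω^ N X x} (h : GenLoop.Homotopic f g) :
    GenLoop.Homotopic (mapLoop φ hφ hx f) (mapLoop φ hφ hx g) := by
  obtain ⟨H, hc, h0, h1, hb⟩ := of_hom h
  refine hom_of (fun y t => φ (H y t)) (hφ.comp hc) ?_ ?_ ?_
  · intro y; simp [h0]
  · intro y; simp [h1]
  · intro y hy t; simp [hb y hy t, hx]

theorem mapLoop_transAt [DecidableEq N] {x : X} {y : Y} (φ : X → Y) (hφ : Continuous φ)
    (hx : φ x = y) (i : N) (f g : Ω^ N X x) :
    mapLoop φ hφ hx (GenLoop.transAt i f g) =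
      GenLoop.transAt i (mapLoop φ hφ hx f) (mapLoop φ hφ hx g) := by
  ext t
  simp only [mapLoop_apply, transAt_apply]
  split_ifs <;> rfl

/-- Group isomorphism from a relation between loops. -/
theorem mulEquiv_of_rel [DecidableEq N] [Nonempty N] [DecidableEq M] [Nonempty M]
    {x : X} {y : Y} (R : Ω^ N X x → Ω^ M Y y → Prop) (i : N) (j : M)
    (htot : ∀ f, ∃ a, R f a) (hsurj : ∀ a, ∃ f, R f a)
    (hfun : ∀ f g a b, R f a → R g b → GenLoop.Homotopic f g → GenLoop.Homotopic a b)
    (hmul : ∀ f g a b, R f a → R g b → R (GenLoop.transAt i f g) (GenLoop.transAt j a b))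
    (hker : ∀ f a, R f a → GenLoop.Homotopic a GenLoop.const → GenLoop.Homotopic f GenLoop.const) :
    Nonempty (HomotopyGroup N X x ≃* HomotopyGroup M Y y) := by
  choose Φ hΦ using htot
  let φ0 : HomotopyGroup N X x → HomotopyGroup M Y y :=
    Quotient.map Φ (fun f g h => hfun f g _ _ (hΦ f) (hΦ g) h)
  have hφ0 : ∀ f a, R f a → φ0 ⟦f⟧ = ⟦a⟧ := by
    intro f a h
    exact Quotient.sound (hfun f f _ _ (hΦ f) h (GenLoop.Homotopic.refl f))
  let φ : HomotopyGroup N X x →* HomotopyGroup M Y y := MonoidHom.mk' φ0 (by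
    intro a b
    induction a using Quotient.inductionOn with | _ f =>
    induction b using Quotient.inductionOn with | _ g =>
    have h1 := HomotopyGroup.mul_spec (i := i) (p := f) (q := g)
    have h2 := HomotopyGroup.mul_spec (i := j) (p := Φ f) (q := Φ g)
    have h3 := hφ0 _ _ (hmul g f _ _ (hΦ g) (hΦ f))
    rw [hφ0 f _ (hΦ f), hφ0 g _ (hΦ g)]
    exact (congrArg φ0 h1).trans (h3.trans h2.symm))
  refine ⟨MulEquiv.ofBijective φ ⟨?_, ?_⟩⟩
  · rw [injective_iff_map_eq_one]
    intro a
    induction a using Quotient.inductionOn with | _ f =>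
    intro h
    have h1 : (⟦Φ f⟧ : HomotopyGroup M Y y) = ⟦GenLoop.const⟧ := h
    exact Quotient.sound (hker f _ (hΦ f) (Quotient.exact h1))
  · intro b
    induction b using Quotient.inductionOn with | _ a =>
    obtain ⟨f, hf⟩ := hsurj a
    exact ⟨⟦f⟧, hφ0 f a hf⟩

/-- homotopy equivalence-type statement for a retraction-like pair. -/
theorem mulEquiv_of_map [DecidableEq N] [Nonempty N] {x : X} {y : Y} (φ : X → Y)
    (hφ : Continuous φ) (hx : φ x = y)
    (hsurj : ∀ a : Ω^ N Y y, ∃ f : Ω^ N X x, GenLoop.Homotopic (mapLoop φ hφ hx f) a)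
    (hker : ∀ f : Ω^ N X x, GenLoop.Homotopic (mapLoop φ hφ hx f) GenLoop.const →
      GenLoop.Homotopic f GenLoop.const) :
    Nonempty (HomotopyGroup N X x ≃* HomotopyGroup N Y y) := by
  let i : N := Classical.arbitrary N
  refine mulEquiv_of_rel (fun f a => GenLoop.Homotopic (mapLoop φ hφ hx f) a) i i
    (fun f => ⟨_, GenLoop.Homotopic.refl _⟩) hsurj ?_ ?_ ?_
  · intro f g a b h1 h2 h3
    exact (h1.symm.trans (mapLoop_hom φ hφ hx h3)).trans h2
  · intro f g a b h1 h2
    rw [mapLoop_transAt]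
    have e1 := HomotopyGroup.mul_spec (i := i) (p := mapLoop φ hφ hx g) (q := mapLoop φ hφ hx f)
    have e2 := HomotopyGroup.mul_spec (i := i) (p := b) (q := a)
    have q1 : (⟦mapLoop φ hφ hx f⟧ : HomotopyGroup N Y y) = ⟦a⟧ := Quotient.sound h1
    have q2 : (⟦mapLoop φ hφ hx g⟧ : HomotopyGroup N Y y) = ⟦b⟧ := Quotient.sound h2
    rw [q1, q2] at e1
    exact Quotient.exact (e1.symm.trans e2)
  · intro f a h1 h2
    exact hker f (h1.trans h2)

theorem mulEquiv_of_homeo [DecidableEq N] [Nonempty N] {x : X} {y : Y} (e : X ≃ₜ Y)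
    (hx : e x = y) : Nonempty (HomotopyGroup N X x ≃* HomotopyGroup N Y y) := by
  have hy : e.symm y = x := by rw [← hx]; simp
  refine mulEquiv_of_map e e.continuous hx ?_ ?_
  · intro a
    refine ⟨mapLoop e.symm e.symm.continuous hy a, ?_⟩
    have : mapLoop e e.continuous hx (mapLoop e.symm e.symm.continuous hy a) = a := by
      ext s; simp
    rw [this]
  · intro f h
    have := mapLoop_hom e.symm e.symm.continuous hy h
    have e1 : mapLoop e.symm e.symm.continuous hy (mapLoop e e.continuous hx f) = f := by
      ext s; simp
    have e2 : mapLoop e.symm e.symm.continuous hy (GenLoop.const : Ω^ N Y y) = GenLoop.const := by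
      ext s; simp [hy]
    rwa [e1, e2] at this

/-! cubes of dimension `n+1` -/

theorem cons_boundary {n : ℕ} {y : I^(Fin (n+1))} :
    y ∈ Cube.boundary (Fin (n+1)) ↔
      y 0 = 0 ∨ y 0 = 1 ∨ Fin.tail y ∈ Cube.boundary (Fin n) := by
  constructor
  · rintro ⟨i, hi⟩
    refine Fin.cases (fun h => ?_) (fun j h => ?_) i hi
    · tauto
    · exact Or.inr (Or.inr ⟨j, h⟩)
  · rintro (h | h | ⟨j, h⟩)
    · exact ⟨0, Or.inl h⟩
    · exact ⟨0, Or.inr h⟩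
    · exact ⟨j.succ, h⟩

theorem continuous_tail {n : ℕ} : Continuous (fun y : I^(Fin (n+1)) => (Fin.tail y : I^(Fin n))) :=
  continuous_pi fun j => continuous_apply j.succ

theorem continuous_cons {n : ℕ} :
    Continuous (fun p : (I^(Fin n)) × I => (Fin.cons p.2 p.1 : I^(Fin (n+1)))) :=
  Continuous.finCons continuous_snd continuous_fst

theorem cons_boundary' {n : ℕ} {s : I^(Fin n)} {t : I} :
    (Fin.cons t s : I^(Fin (n+1))) ∈ Cube.boundary (Fin (n+1)) ↔
      t = 0 ∨ t = 1 ∨ s ∈ Cube.boundary (Fin n) := by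
  rw [cons_boundary]; simp

/-- family of loops to loop -/
def famLoop {n : ℕ} {x : X} (F : (I^(Fin n)) → I → X)
    (hc : Continuous fun p : (I^(Fin n)) × I => F p.1 p.2)
    (h0 : ∀ s, F s 0 = x) (h1 : ∀ s, F s 1 = x) (hb : ∀ s ∈ Cube.boundary (Fin n), ∀ t, F s t = x) :
    Ω^ (Fin (n+1)) X x :=
  mkLoop (fun y => F (Fin.tail y) (y 0))
    (hc.comp (continuous_tail.prodMk (continuous_apply 0)))
    (by
      intro y hy
      rcases cons_boundary.1 hy with h | h | h
      · rw [h, h0]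
      · rw [h, h1]
      · exact hb _ h _)

@[simp] theorem famLoop_apply {n : ℕ} {x : X} (F : (I^(Fin n)) → I → X)
    (hc : Continuous fun p : (I^(Fin n)) × I => F p.1 p.2)
    (h0 : ∀ s, F s 0 = x) (h1 : ∀ s, F s 1 = x) (hb : ∀ s ∈ Cube.boundary (Fin n), ∀ t, F s t = x)
    (y : I^(Fin (n+1))) : famLoop F hc h0 h1 hb y = F (Fin.tail y) (y 0) := rfl

/-- loop as family -/
def unfam {n : ℕ} {x : X} (f : Ω^ (Fin (n+1)) X x) (s : I^(Fin n)) (t : I) : X :=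
  f (Fin.cons t s : I^(Fin (n+1)))

theorem unfam_cont {n : ℕ} {x : X} (f : Ω^ (Fin (n+1)) X x) :
    Continuous fun p : (I^(Fin n)) × I => unfam f p.1 p.2 :=
  (loop_cont f).comp continuous_cons

theorem unfam_zero {n : ℕ} {x : X} (f : Ω^ (Fin (n+1)) X x) (s : I^(Fin n)) : unfam f s 0 = x :=
  loop_bd f _ (cons_boundary'.2 (Or.inl rfl))

theorem unfam_one {n : ℕ} {x : X} (f : Ω^ (Fin (n+1)) X x) (s : I^(Fin n)) : unfam f s 1 = x :=
  loop_bd f _ (cons_boundary'.2 (Or.inr (Or.inl rfl)))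

theorem unfam_bd {n : ℕ} {x : X} (f : Ω^ (Fin (n+1)) X x) (s : I^(Fin n))
    (hs : s ∈ Cube.boundary (Fin n)) (t : I) : unfam f s t = x :=
  loop_bd f _ (cons_boundary'.2 (Or.inr (Or.inr hs)))

theorem unfam_tail {n : ℕ} {x : X} (f : Ω^ (Fin (n+1)) X x) (y : I^(Fin (n+1))) :
    unfam f (Fin.tail y) (y 0) = f y := by
  unfold unfam; rw [Fin.cons_self_tail]

/-- concatenation for plain functions on cubes -/
def catFun {n : ℕ} {A : Type} (j : Fin n) (F G : (I^(Fin n)) → A) (s : I^(Fin n)) : A :=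
  if (s j : ℝ) ≤ 1 / 2
      then F (Function.update s j <| Set.projIcc 0 1 zero_le_one (2 * s j))
      else G (Function.update s j <| Set.projIcc 0 1 zero_le_one (2 * s j - 1))

theorem transAt_cat {n : ℕ} {x : X} (j : Fin n) (f g : Ω^ (Fin n) X x) (s) :
    GenLoop.transAt j f g s = catFun j f g s := rfl

theorem unfam_transAt {n : ℕ} {x : X} (j : Fin n) (f g : Ω^ (Fin (n+1)) X x) (s) (t) :
    unfam (GenLoop.transAt j.succ f g) s t =
      catFun j (fun s => unfam f s t) (fun s => unfam g s t) s := by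
  unfold unfam
  rw [transAt_apply]
  unfold catFun
  simp only [Fin.cons_succ, Fin.cons_update]

/-- continuity of concatenated families agreeing on boundary values -/
theorem catFun_cont {n : ℕ} {A : Type} [TopologicalSpace A] (j : Fin n)
    (F G : (I^(Fin n)) → A → X) (c : A → X)
    (hF : Continuous fun p : (I^(Fin n)) × A => F p.1 p.2)
    (hG : Continuous fun p : (I^(Fin n)) × A => G p.1 p.2)
    (hFb : ∀ s ∈ Cube.boundary (Fin n), ∀ t, F s t = c t)
    (hGb : ∀ s ∈ Cube.boundary (Fin n), ∀ t, G s t = c t) :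
    Continuous fun p : (I^(Fin n)) × A =>
      catFun j (fun s => F s p.2) (fun s => G s p.2) p.1 := by
  unfold catFun
  have hu : ∀ (k : ℝ), Continuous fun p : (I^(Fin n)) × A =>
      (Function.update p.1 j (Set.projIcc (0:ℝ) 1 zero_le_one (2 * p.1 j - k)) : I^(Fin n)) := by
    intro k
    refine Continuous.update continuous_fst j ?_
    refine continuous_projIcc.comp ?_
    fun_prop
  refine Continuous.if_le ?_ ?_ (by fun_prop) continuous_const ?_
  · have := hF.comp ((hu 0).prodMk continuous_snd)
    simpa [Function.comp_def] using this
  · exact hG.comp ((hu 1).prodMk continuous_snd)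
  · intro p hp
    beta_reduce
    rw [hFb, hGb]
    · refine ⟨j, Or.inl ?_⟩
      rw [hp]; simp [Set.projIcc]
    · refine ⟨j, Or.inr ?_⟩
      rw [hp]; simp [Set.projIcc]

theorem catFun_bd {n : ℕ} {A : Type} (j : Fin n) (F G : (I^(Fin n)) → A) (c : A)
    (hF : ∀ s ∈ Cube.boundary (Fin n), F s = c) (hG : ∀ s ∈ Cube.boundary (Fin n), G s = c)
    (s) (hs : s ∈ Cube.boundary (Fin n)) : catFun j F G s = c := by
  unfold catFun
  obtain ⟨i, hi⟩ := hs
  by_cases hij : i = j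
  · subst hij
    rcases hi with h | h
    · rw [h]
      simp only [Set.Icc.coe_zero]
      rw [if_pos (by norm_num)]
      exact hF _ ⟨i, Or.inl (by simp [Set.projIcc])⟩
    · rw [h]
      simp only [Set.Icc.coe_one]
      rw [if_neg (by norm_num)]
      exact hG _ ⟨i, Or.inr (by norm_num [Set.projIcc])⟩
  · split_ifs
    · exact hF _ ⟨i, by rwa [Function.update_of_ne hij]⟩
    · exact hG _ ⟨i, by rwa [Function.update_of_ne hij]⟩

theorem catFun_map {n : ℕ} {A B : Type} (φ : A → B) (j : Fin n) (F G : (I^(Fin n)) → A) (s) :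
    φ (catFun j F G s) = catFun j (fun s => φ (F s)) (fun s => φ (G s)) s := by
  unfold catFun; split_ifs <;> rfl

end PartA

section PartB

open unitInterval Topology.Homotopy

variable {G X H K : Type} [TopologicalSpace G] [TopologicalSpace X] [TopologicalSpace H]
  [TopologicalSpace K]

/-- local transporter for a map `p` out of a group -/
structure Transp [Group G] (p : G → X) where
  T : X → X → G
  D : Set (X × X)
  openD : IsOpen D
  diag : ∀ x, (x, x) ∈ D
  cont : ContinuousOn (fun q : X × X => T q.1 q.2) D
  spec : ∀ x y, (x, y) ∈ D → ∀ g, p g = x → p (T x y * g) = y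
  one : ∀ x, T x x = 1

theorem exists_step [CompactSpace K] (D : Set (X × X)) (hD : IsOpen D) (hd : ∀ x, (x, x) ∈ D)
    (F : K → I → X) (hF : Continuous fun q : K × I => F q.1 q.2) :
    ∃ δ > 0, ∀ k t t', dist t t' < δ → (F k t, F k t') ∈ D := by
  let C : Set (K × I × I) := {q | (F q.1 q.2.1, F q.1 q.2.2) ∉ D}
  have hC : IsClosed C := by
    have h1 : Continuous fun q : K × I × I => (F q.1 q.2.1, F q.1 q.2.2) := by
      refine Continuous.prodMk ?_ ?_
      · exact hF.comp (continuous_fst.prodMk (continuous_fst.comp continuous_snd))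
      · exact hF.comp (continuous_fst.prodMk (continuous_snd.comp continuous_snd))
    exact (hD.preimage h1).isClosed_compl
  have hcC : IsCompact C := hC.isCompact
  rcases C.eq_empty_or_nonempty with he | hne
  · refine ⟨1, one_pos, fun k t t' _ => ?_⟩
    by_contra hcon
    have : (k, t, t') ∈ C := hcon
    rw [he] at this; exact this
  · obtain ⟨q, hq, hmin⟩ := hcC.exists_isMinOn hne
      (f := fun q : K × I × I => dist q.2.1 q.2.2) (by fun_prop)
    refine ⟨dist q.2.1 q.2.2, ?_, ?_⟩
    · rw [gt_iff_lt, dist_pos]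
      intro h
      apply hq
      simp only [h]
      exact hd _
    · intro k t t' h
      by_contra hcon
      have h2 := hmin (show (k, t, t') ∈ C from hcon)
      simp only [Set.mem_ofPred_eq] at h2
      linarith

variable [Group G] [IsTopologicalGroup G]

theorem Transp.lift [CompactSpace K] {p : G → X} (τ : Transp p)
    (F : K → I → X) (hF : Continuous fun q : K × I => F q.1 q.2)
    (g0 : K → G) (hg0 : Continuous g0) (h0 : ∀ k, p (g0 k) = F k 0) :
    ∃ L : K → I → G, (Continuous fun q : K × I => L q.1 q.2) ∧
      (∀ k t, p (L k t) = F k t) ∧ (∀ k, L k 0 = g0 k) ∧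
      (∀ k, (∀ t, F k t = F k 0) → ∀ t, L k t = g0 k) := by
  obtain ⟨δ, hδ, hstep⟩ := exists_step τ.D τ.openD τ.diag F hF
  obtain ⟨N, hN⟩ := exists_nat_one_div_lt hδ
  let c : ℕ → I → I := fun m t => Set.projIcc (0:ℝ) 1 zero_le_one (min t (m / (N + 1)))
  have hc : ∀ m, Continuous (c m) := fun m => continuous_projIcc.comp (by fun_prop)
  have hcval : ∀ m t, ((c m t : I) : ℝ) = min (t : ℝ) ((m : ℝ) / ((N : ℝ) + 1)) := by
    intro m t
    have h1 : min (t : ℝ) (m / (N + 1)) ∈ Set.Icc (0:ℝ) 1 :=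
      ⟨le_min t.2.1 (by positivity), (min_le_left _ _).trans t.2.2⟩
    change ((Set.projIcc (0:ℝ) 1 zero_le_one (min t (m / (N + 1))) : I) : ℝ) = _
    rw [Set.projIcc_of_mem zero_le_one h1]
  have hcd : ∀ m t, dist (c m t) (c (m+1) t) < δ := by
    intro m t
    rw [Subtype.dist_eq, hcval, hcval, Real.dist_eq]
    refine lt_of_le_of_lt ?_ hN
    have h2 : ((m + 1 : ℕ) : ℝ) / (N + 1) = m / (N + 1) + 1 / (N + 1) := by
      push_cast; ring
    have h3 : (0:ℝ) < 1 / (N + 1) := by positivity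
    rw [h2, abs_le]
    constructor
    · rcases le_total (t:ℝ) (m / (N + 1)) with h | h
      · rw [min_eq_left h, min_eq_left (by linarith)]; linarith
      · rw [min_eq_right h]
        have := min_le_right (t:ℝ) (m / (N + 1) + 1 / (N + 1))
        linarith
    · have : min (t:ℝ) (m / (N + 1)) ≤ min (t:ℝ) (m / (N + 1) + 1 / (N + 1)) :=
        min_le_min_left _ (by linarith)
      linarith
  obtain ⟨g, hgz, hgs⟩ : ∃ g : ℕ → K → I → G, (∀ k t, g 0 k t = g0 k) ∧
      (∀ m k t, g (m+1) k t = τ.T (F k (c m t)) (F k (c (m+1) t)) * g m k t) :=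
    ⟨fun m => Nat.rec (fun k _ => g0 k)
      (fun m g k t => τ.T (F k (c m t)) (F k (c (m+1) t)) * g k t) m,
      fun _ _ => rfl, fun _ _ _ => rfl⟩
  have hgc : ∀ m, Continuous fun q : K × I => g m q.1 q.2 := by
    intro m
    induction m with
    | zero => simp only [hgz]; exact hg0.comp continuous_fst
    | succ m ih =>
      simp only [hgs]
      refine Continuous.mul ?_ ih
      have h1 : ∀ m, Continuous fun q : K × I => F q.1 (c m q.2) := fun m =>
        hF.comp (continuous_fst.prodMk ((hc m).comp continuous_snd))
      exact τ.cont.comp_continuous ((h1 m).prodMk (h1 (m+1)))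
        (fun q => hstep _ _ _ (hcd m q.2))
  have hgp : ∀ m k t, p (g m k t) = F k (c m t) := by
    intro m k t
    induction m with
    | zero =>
      have : c 0 t = 0 := by
        apply Subtype.ext; rw [hcval]; simp [t.2.1]
      rw [this, hgz]; exact h0 k
    | succ m ih =>
      rw [hgs]
      exact τ.spec _ _ (hstep _ _ _ (hcd m t)) _ ih
  refine ⟨g (N+1), hgc (N+1), ?_, ?_, ?_⟩
  · intro k t
    rw [hgp]
    congr 1
    apply Subtype.ext
    rw [hcval]
    push_cast
    rw [div_self (by positivity), min_eq_left t.2.2]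
  · intro k
    have : ∀ m, g m k 0 = g0 k := by
      intro m
      induction m with
      | zero => exact hgz _ _
      | succ m ih =>
        have hz : ∀ m, c m 0 = 0 := by
          intro m
          apply Subtype.ext; rw [hcval]; simp; positivity
        rw [hgs, ih, hz, hz, τ.one, one_mul]
    exact this _
  · intro k hk t
    have : ∀ m, g m k t = g0 k := by
      intro m
      induction m with
      | zero => exact hgz _ _
      | succ m ih =>
        rw [hgs, ih, hk (c m t), hk (c (m+1) t), τ.one, one_mul]
    exact this _

variable [Group H] [IsTopologicalGroup H]

/-- homogeneous fibration data -/
structure Fib (G X H : Type) [TopologicalSpace G] [TopologicalSpace X] [TopologicalSpace H]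
    [Group G] [IsTopologicalGroup G] [Group H] [IsTopologicalGroup H] (x0 : X) where
  p : G → X
  pc : Continuous p
  p1 : p 1 = x0
  τ : Transp p
  ι : H →* G
  emb : Topology.IsEmbedding ι
  fib : ∀ g g', p g = p g' ↔ ∃ h, g' = g * ι h

namespace Fib

variable {x0 : X} (Φ : Fib G X H x0) {n : ℕ}

/-- the boundary relation -/
def Bd (f : Ω^ (Fin (n+1)) X x0) (a : Ω^ (Fin n) H 1) : Prop :=
  ∃ L : (I^(Fin n)) → I → G, (Continuous fun q : (I^(Fin n)) × I => L q.1 q.2) ∧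
    (∀ s t, Φ.p (L s t) = unfam f s t) ∧ (∀ s, L s 0 = 1) ∧
    (∀ s ∈ Cube.boundary (Fin n), ∀ t, L s t = 1) ∧ (∀ s, L s 1 = Φ.ι (a s))

/-- a family in `G` with trivial image relation can be expressed in `H` -/
theorem toH {A : Type} [TopologicalSpace A] (u : A → G) (hu : Continuous u)
    (h : ∀ a, Φ.p (u a) = x0) : ∃ v : A → H, Continuous v ∧ ∀ a, Φ.ι (v a) = u a := by
  have h1 : ∀ a, ∃ k, u a = Φ.ι k := by
    intro a
    have := (Φ.fib 1 (u a)).1 (by rw [h, Φ.p1])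
    simpa using this
  choose v hv using h1
  refine ⟨v, ?_, fun a => (hv a).symm⟩
  rw [Φ.emb.continuous_iff]
  have : Φ.ι ∘ v = u := by ext1 a; exact (hv a).symm
  rw [this]; exact hu

theorem toH2 {A : Type} [TopologicalSpace A] (u u' : A → G) (hu : Continuous u)
    (hu' : Continuous u') (h : ∀ a, Φ.p (u a) = Φ.p (u' a)) :
    ∃ v : A → H, Continuous v ∧ ∀ a, u' a = u a * Φ.ι (v a) := by
  obtain ⟨v, hv, hv'⟩ := Φ.toH (fun a => (u a)⁻¹ * u' a) (hu.inv.mul hu') (by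
    intro a
    obtain ⟨k, hk⟩ := (Φ.fib _ _).1 (h a)
    rw [hk]
    refine Eq.trans ?_ Φ.p1
    symm
    rw [Φ.fib]
    exact ⟨k, by group⟩)
  exact ⟨v, hv, fun a => by rw [hv' a]; group⟩

theorem p_mul_ι (g : G) (h : H) : Φ.p (g * Φ.ι h) = Φ.p g := ((Φ.fib _ _).2 ⟨h, rfl⟩).symm

theorem ι_inj : Function.Injective Φ.ι := Φ.emb.injective

theorem bd_total (f : Ω^ (Fin (n+1)) X x0) : ∃ a, Φ.Bd f a := by
  obtain ⟨L, hc, hp, h0, hs⟩ := Φ.τ.lift (unfam f) (unfam_cont f) (fun _ => 1) continuous_const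
    (fun k => by rw [unfam_zero, Φ.p1])
  obtain ⟨v, hv, hv'⟩ := Φ.toH (fun s => L s 1)
    (hc.comp (continuous_id.prodMk continuous_const)) (fun s => by rw [hp, unfam_one])
  have hb : ∀ s ∈ Cube.boundary (Fin n), ∀ t, L s t = 1 := by
    intro s hss
    exact hs s (fun t => by rw [unfam_bd f s hss, unfam_bd f s hss])
  refine ⟨mkLoop v hv ?_, L, hc, hp, h0, hb, fun s => (hv' s).symm⟩
  intro s hss
  apply Φ.ι_inj
  rw [hv', hb s hss, map_one]

/-- adjusting the end of a lift -/
theorem bd_adjust (f : Ω^ (Fin (n+1)) X x0) (a b : Ω^ (Fin n) H 1) (h : Φ.Bd f a)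
    (hab : GenLoop.Homotopic a b) : Φ.Bd f b := by
  obtain ⟨L, hc, hp, h0, hb, h1⟩ := h
  obtain ⟨E, ec, e0, e1, eb⟩ := of_hom hab
  refine ⟨fun s t => L s t * Φ.ι ((a s)⁻¹ * E s t), ?_, ?_, ?_, ?_, ?_⟩
  · refine hc.mul (Φ.emb.continuous.comp ?_)
    exact (((loop_cont a).comp continuous_fst).inv).mul ec
  · intro s t
    rw [Φ.p_mul_ι, hp]
  · intro s
    beta_reduce; rw [h0, e0]; simp
  · intro s hs t
    beta_reduce; rw [hb s hs, eb s hs, loop_bd a s hs]; simp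
  · intro s
    beta_reduce; rw [h1, e1, ← map_mul]; simp

theorem bd_same (f : Ω^ (Fin (n+1)) X x0) (a b : Ω^ (Fin n) H 1) (ha : Φ.Bd f a)
    (hb : Φ.Bd f b) : GenLoop.Homotopic a b := by
  obtain ⟨L', hc', hp', h0', hb', h1'⟩ := hb
  obtain ⟨L, hc, hp, h0, hb, h1⟩ := ha
  obtain ⟨v, hv, hv'⟩ := Φ.toH2 (fun q : (I^(Fin n)) × I => L q.1 q.2) (fun q => L' q.1 q.2)
    hc hc' (fun q => by rw [hp, hp'])
  refine hom_of (fun s t => a s * v (s, t)) ?_ ?_ ?_ ?_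
  · exact ((loop_cont a).comp continuous_fst).mul hv
  · intro s
    have := hv' (s, 0)
    simp only [h0, h0'] at this
    have h2 : v (s, 0) = 1 := by
      apply Φ.ι_inj; rw [map_one]; simpa using this.symm
    rw [h2, mul_one]
  · intro s
    have := hv' (s, 1)
    simp only [h1, h1'] at this
    rw [← map_mul] at this
    exact (Φ.ι_inj this).symm
  · intro s hs t
    have := hv' (s, t)
    simp only [hb s hs, hb' s hs] at this
    have h2 : v (s, t) = 1 := by
      apply Φ.ι_inj; rw [map_one]; simpa using this.symm
    rw [h2, mul_one, loop_bd a s hs]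

theorem bd_fun (f g : Ω^ (Fin (n+1)) X x0) (a b : Ω^ (Fin n) H 1) (ha : Φ.Bd f a)
    (hb : Φ.Bd g b) (hfg : GenLoop.Homotopic f g) : GenLoop.Homotopic a b := by
  obtain ⟨E, ec, e0, e1, eb⟩ := of_hom hfg
  obtain ⟨L, hc, hp, h0, hs⟩ := Φ.τ.lift (K := (I^(Fin n)) × I)
    (fun k t => E (Fin.cons t k.1 : I^(Fin (n+1))) k.2)
    (ec.comp (Continuous.prodMk (continuous_cons.comp
      ((continuous_fst.comp continuous_fst).prodMk continuous_snd))
      (continuous_snd.comp continuous_fst)))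
    (fun _ => 1) continuous_const
    (fun k => by rw [eb _ (cons_boundary'.2 (Or.inl rfl)), Φ.p1])
  have hbd : ∀ s ∈ Cube.boundary (Fin n), ∀ u t, L (s, u) t = 1 := by
    intro s hss u
    refine hs (s, u) (fun t => ?_)
    rw [eb _ (cons_boundary'.2 (Or.inr (Or.inr hss))),
      eb _ (cons_boundary'.2 (Or.inr (Or.inr hss)))]
  obtain ⟨v, hv, hv'⟩ := Φ.toH (fun q : (I^(Fin n)) × I => L q 1)
    (hc.comp (continuous_id.prodMk continuous_const))
    (fun q => by rw [hp, eb _ (cons_boundary'.2 (Or.inr (Or.inl rfl)))])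
  have hvb : ∀ s ∈ Cube.boundary (Fin n), ∀ u, v (s, u) = 1 := by
    intro s hss u
    apply Φ.ι_inj; rw [hv', hbd s hss, map_one]
  have key : ∀ u : I, ∀ f' : Ω^ (Fin (n+1)) X x0, (∀ y, E y u = f' y) →
      Φ.Bd f' (mkLoop (fun s => v (s, u)) (hv.comp (continuous_id.prodMk continuous_const))
        (fun s hss => hvb s hss u)) := by
    intro u f' hf'
    refine ⟨fun s t => L (s, u) t, ?_, ?_, ?_, ?_, ?_⟩
    · exact hc.comp ((continuous_fst.prodMk continuous_const).prodMk continuous_snd)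
    · intro s t; rw [hp]; exact hf' _
    · intro s; exact h0 _
    · intro s hss t; exact hbd s hss u t
    · intro s; exact (hv' _).symm
  have k0 := Φ.bd_same f _ _ ha (key 0 f e0)
  have k1 := Φ.bd_same g _ _ (key 1 g e1) hb
  refine (k0.trans ?_).trans k1
  exact hom_of (fun s u => v (s, u)) hv (fun _ => rfl) (fun _ => rfl) hvb

theorem bd_mul (j : Fin n) (f g : Ω^ (Fin (n+1)) X x0) (a b : Ω^ (Fin n) H 1) (ha : Φ.Bd f a)
    (hb : Φ.Bd g b) : Φ.Bd (GenLoop.transAt j.succ f g) (GenLoop.transAt j a b) := by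
  obtain ⟨L', hc', hp', h0', hb', h1'⟩ := hb
  obtain ⟨L, hc, hp, h0, hb, h1⟩ := ha
  refine ⟨fun s t => catFun j (fun s => L s t) (fun s => L' s t) s, ?_, ?_, ?_, ?_, ?_⟩
  · exact catFun_cont j L L' (fun _ => 1) hc hc' hb hb'
  · intro s t
    rw [unfam_transAt, catFun_map Φ.p]
    simp only [hp, hp']
  · intro s
    simp only [h0, h0']
    simp [catFun]
  · intro s hs t
    exact catFun_bd j _ _ _ (fun s hs => hb s hs t) (fun s hs => hb' s hs t) s hs
  · intro s
    simp only [h1, h1']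
    rw [transAt_cat, catFun_map Φ.ι]

/-- pushing loops of `H` into `G` -/
def incl (a : Ω^ (Fin n) H 1) : Ω^ (Fin n) G 1 :=
  mapLoop Φ.ι Φ.emb.continuous (map_one _) a

@[simp] theorem incl_apply (a : Ω^ (Fin n) H 1) (s) : Φ.incl a s = Φ.ι (a s) := rfl

theorem bd_ker (hsurj : ∀ g : Ω^ (Fin (n+1)) G 1, ∃ a, GenLoop.Homotopic g (Φ.incl a))
    (f : Ω^ (Fin (n+1)) X x0) (a : Ω^ (Fin n) H 1) (h : Φ.Bd f a)
    (h1 : GenLoop.Homotopic a GenLoop.const) : GenLoop.Homotopic f GenLoop.const := by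
  obtain ⟨L, hc, hp, h0, hb, h1⟩ := Φ.bd_adjust f a _ h h1
  let g : Ω^ (Fin (n+1)) G 1 := famLoop L hc h0 (fun s => by rw [h1]; simp) hb
  obtain ⟨b, hb⟩ := hsurj g
  have h2 := mapLoop_hom Φ.p Φ.pc Φ.p1 hb
  have h3 : mapLoop Φ.p Φ.pc Φ.p1 g = f := by
    ext y; simp [g, hp, unfam_tail]
  have h4 : mapLoop Φ.p Φ.pc Φ.p1 (Φ.incl b) = GenLoop.const := by
    ext y
    have := Φ.p_mul_ι 1 (b y)
    simpa [Φ.p1] using this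
  rwa [h3, h4] at h2

theorem bd_of_null (a : Ω^ (Fin n) H 1) (h : GenLoop.Homotopic (Φ.incl a) GenLoop.const) :
    ∃ f, Φ.Bd f a := by
  obtain ⟨E, ec, e0, e1, eb⟩ := of_hom h.symm
  refine ⟨famLoop (fun s t => Φ.p (E s t)) (Φ.pc.comp ec) ?_ ?_ ?_, E, ec, ?_, ?_, eb, ?_⟩
  · intro s; simp [e0, Φ.p1]
  · intro s
    have := Φ.p_mul_ι 1 (a s)
    simpa [e1, Φ.p1] using this
  · intro s hs t; simp [eb s hs, Φ.p1]
  · intro s t; simp [unfam]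
  · intro s; simp [e0]
  · intro s; simp [e1]

theorem null_of_bd (f) (a : Ω^ (Fin n) H 1) (h : Φ.Bd f a) :
    GenLoop.Homotopic (Φ.incl a) GenLoop.const := by
  obtain ⟨L, hc, hp, h0, hb, h1⟩ := h
  refine GenLoop.Homotopic.symm (hom_of L hc ?_ ?_ hb)
  · intro s; simp [h0]
  · intro s; simp [h1]

/-- if `π_n H → π_n G` is zero and `π_{n+1} H → π_{n+1} G` onto, the boundary map is an iso -/
theorem equiv_of_null (hsurj : ∀ g : Ω^ (Fin (n+1+1)) G 1, ∃ a, GenLoop.Homotopic g (Φ.incl a))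
    (hnull : ∀ a : Ω^ (Fin (n+1)) H 1, GenLoop.Homotopic (Φ.incl a) GenLoop.const) :
    Nonempty (HomotopyGroup (Fin (n+1+1)) X x0 ≃* HomotopyGroup (Fin (n+1)) H 1) :=
  mulEquiv_of_rel Φ.Bd (Fin.succ 0) 0 Φ.bd_total (fun a => Φ.bd_of_null a (hnull a))
    Φ.bd_fun (Φ.bd_mul 0) (Φ.bd_ker hsurj)

end Fib

end PartB

section PartC

open unitInterval Topology.Homotopy

variable {E : Type} [NormedAddCommGroup E] [InnerProductSpace ℝ E]

local notation "Sph" => Metric.sphere (0 : E) 1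

theorem sph_norm (x : Sph) : ‖(x : E)‖ = 1 := by simpa using x.2

/-- normalisation into the sphere -/
def nrm (w : E) (h : w ≠ 0) : Sph := ⟨‖w‖⁻¹ • w, by
  simp [norm_smul, norm_ne_zero_iff.2 h]⟩

theorem nrm_cont {K : Type} [TopologicalSpace K] (w : K → E) (hw : Continuous w)
    (h : ∀ k, w k ≠ 0) : Continuous fun k => nrm (w k) (h k) := by
  refine Continuous.subtype_mk ?_ _
  exact (hw.norm.inv₀ (fun k => norm_ne_zero_iff.2 (h k))).smul hw

theorem nrm_self (x : Sph) (h : (x : E) ≠ 0) : nrm (x : E) h = x := by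
  apply Subtype.ext; simp [nrm, sph_norm x]

theorem nrm_congr {w w' : E} (e : w = w') (h : w ≠ 0) (h' : w' ≠ 0) : nrm w h = nrm w' h' := by
  subst e; rfl

theorem sph_ne_zero (x : Sph) : (x : E) ≠ 0 := by
  intro h; have := sph_norm x; rw [h] at this; simp at this

/-- lines in the sphere minus a point, in the stereographic chart -/
def sl (p x y : Sph) (t : ℝ) : Sph :=
  (stereographic (sph_norm p)).symm
    ((1 - t) • stereographic (sph_norm p) x + t • stereographic (sph_norm p) y)

theorem st_mem (p x : Sph) (h : x ≠ p) : x ∈ (stereographic (sph_norm p)).source := by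
  rw [stereographic_source]; simpa using h

theorem sl_ne (p x y : Sph) (t : ℝ) : sl p x y t ≠ p := by
  have h : sl p x y t ∈ (stereographic (sph_norm p)).source :=
    (stereographic (sph_norm p)).map_target (by rw [stereographic_target]; trivial)
  rw [stereographic_source] at h
  simpa using h

theorem sl_zero (p x y : Sph) (hx : x ≠ p) : sl p x y 0 = x := by
  simp only [sl, sub_zero, one_smul, zero_smul, add_zero]
  exact (stereographic (sph_norm p)).left_inv (st_mem p x hx)

theorem sl_one (p x y : Sph) (hy : y ≠ p) : sl p x y 1 = y := by
  simp only [sl, sub_self, one_smul, zero_smul, zero_add]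
  exact (stereographic (sph_norm p)).left_inv (st_mem p y hy)

theorem sl_same (p x : Sph) (t : ℝ) (hx : x ≠ p) : sl p x x t = x := by
  have : sl p x x t = sl p x x 0 := by
    unfold sl; congr 1; module
  rw [this, sl_zero p x x hx]

theorem st_cont {K : Type} [TopologicalSpace K] (p : Sph) (x : K → Sph) (hx : Continuous x)
    (hxp : ∀ k, x k ≠ p) : Continuous fun k => stereographic (sph_norm p) (x k) :=
  (stereographic (sph_norm p)).continuousOn.comp_continuous hx (fun k => st_mem p _ (hxp k))

theorem sl_cont {K : Type} [TopologicalSpace K] (p : Sph) (x y : K → Sph) (t : K → ℝ)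
    (hx : Continuous x) (hy : Continuous y) (ht : Continuous t)
    (hxp : ∀ k, x k ≠ p) (hyp : ∀ k, y k ≠ p) :
    Continuous fun k => sl p (x k) (y k) (t k) := by
  have h1 : Continuous (stereographic (sph_norm p)).symm := by
    rw [← continuousOn_univ, ← stereographic_target (sph_norm p)]
    exact (stereographic (sph_norm p)).continuousOn_symm
  refine h1.comp ?_
  have := st_cont p x hx hxp
  have := st_cont p y hy hyp
  fun_prop

variable [FiniteDimensional ℝ E]

theorem approx_cube {k : ℕ} (f : (I^(Fin k)) → E) (hf : Continuous f) {ε : ℝ} (hε : 0 < ε) :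
    ∃ g : (Fin k → ℝ) → E, ContDiff ℝ 1 g ∧
      ∀ y : I^(Fin k), ‖g (fun i => (y i : ℝ)) - f y‖ < ε := by
  let f' : (Fin k → ℝ) → E := fun x => f (fun i => Set.projIcc (0:ℝ) 1 zero_le_one (x i))
  have hf' : Continuous f' := hf.comp (continuous_pi fun i =>
    continuous_projIcc.comp (continuous_apply i))
  obtain ⟨g, hg, hgd, -⟩ := hf'.exists_contDiff_approx 1 (ε := fun _ => ε) continuous_const
    (fun _ => hε)
  refine ⟨g, hg, fun y => ?_⟩
  have := hgd (fun i => (y i : ℝ))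
  rw [dist_eq_norm] at this
  simpa [f'] using this

theorem norm_nrm_sub (x : Sph) (w : E) (h : w ≠ 0) :
    ‖((nrm w h : Sph) : E) - x‖ ≤ 2 * ‖w - x‖ := by
  have h1 : ((nrm w h : Sph) : E) - x = (‖w‖⁻¹ • w - w) + (w - x) := by simp [nrm]
  have h2 : ‖‖w‖⁻¹ • w - w‖ = |1 - ‖w‖| := by
    have : ‖w‖⁻¹ • w - w = (‖w‖⁻¹ - 1) • w := by module
    rw [this, norm_smul, Real.norm_eq_abs, ← abs_of_nonneg (norm_nonneg w), ← abs_mul]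
    congr 1
    have := norm_ne_zero_iff.2 h
    simp; field_simp
  have h3 : |1 - ‖w‖| ≤ ‖w - x‖ := by
    have := abs_norm_sub_norm_le w (x : E)
    rw [sph_norm x] at this
    rw [abs_sub_comm]; exact this
  rw [h1]
  calc _ ≤ _ := norm_add_le _ _
    _ ≤ _ := by rw [h2]; linarith

theorem nrm_eq {w : E} {h : w ≠ 0} {x : Sph} (e : nrm w h = x) : w = ‖w‖ • (x : E) := by
  have h0 := norm_ne_zero_iff.2 h
  rw [← e]; simp [nrm, smul_smul, h0]

/-- spheres of dimension `> k` have trivial `π_k` -/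
theorem sphere_null {k : ℕ} (hk : k + 1 < Module.finrank ℝ E) (e : Sph)
    (f : Ω^ (Fin k) Sph e) : GenLoop.Homotopic f GenLoop.const := by
  obtain ⟨g, hg, hgf⟩ := approx_cube (fun y => ((f y : Sph) : E))
    (continuous_subtype_val.comp (loop_cont f)) (ε := 1/8) (by norm_num)
  have hdense : Dense (Set.range fun q : (Fin k → ℝ) × ℝ => q.2 • g q.1)ᶜ := by
    refine ContDiff.dense_compl_range_of_finrank_lt_finrank ?_ (by simpa using hk)
    exact contDiff_snd.smul (hg.comp contDiff_fst)
  obtain ⟨q, hq, hqe⟩ := hdense.exists_dist_lt (-(e : E)) (ε := 1/8) (by norm_num)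
  have he1 := sph_norm e
  have hqe' : inner ℝ q (e : E) < 0 := by
    have h1 : inner ℝ q (e : E) = inner ℝ (q + e) (e : E) - 1 := by
      rw [inner_add_left, real_inner_self_eq_norm_sq, he1]; ring
    have h2 := real_inner_le_norm (q + e) (e : E)
    have h3 : ‖q + e‖ < 1/8 := by
      rw [dist_comm, dist_eq_norm] at hqe; simpa using hqe
    rw [he1] at h2
    linarith
  have hq0 : q ≠ 0 := by rintro rfl; simp at hqe'
  let χ : (I^(Fin k)) → ℝ := fun y => min 1 ‖((f y : Sph) : E) - e‖
  have hfc : Continuous fun y => ((f y : Sph) : E) := continuous_subtype_val.comp (loop_cont f)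
  have hχc : Continuous χ := by fun_prop
  have hχ0 : ∀ y, 0 ≤ χ y := fun y => le_min zero_le_one (norm_nonneg _)
  have hχ1 : ∀ y, χ y ≤ 1 := fun y => min_le_left _ _
  let G : (I^(Fin k)) → E := fun y => g (fun i => (y i : ℝ))
  have hGc : Continuous G := hg.continuous.comp (by fun_prop)
  let w : (I^(Fin k)) → I → E := fun y u => (f y : Sph) + ((u : ℝ) * χ y) • (G y - (f y : Sph))
  have hwc : Continuous fun p : (I^(Fin k)) × I => w p.1 p.2 := by fun_prop
  have hwf : ∀ y u, ‖w y u - (f y : Sph)‖ ≤ 1/8 := by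
    intro y u
    simp only [w, add_sub_cancel_left, norm_smul, Real.norm_eq_abs]
    have h1 : |(u : ℝ) * χ y| ≤ 1 := by
      rw [abs_of_nonneg (mul_nonneg u.2.1 (hχ0 y))]
      exact mul_le_one₀ u.2.2 (hχ0 y) (hχ1 y)
    have h2 := (hgf y).le
    calc _ ≤ 1 * ‖G y - (f y : Sph)‖ := by gcongr
      _ ≤ _ := by rw [one_mul]; exact h2
  have hw0 : ∀ y u, w y u ≠ 0 := by
    intro y u h
    have := hwf y u
    rw [h, zero_sub, norm_neg, sph_norm] at this
    norm_num at this
  have hχb : ∀ y ∈ Cube.boundary (Fin k), χ y = 0 := by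
    intro y hy; simp [χ, loop_bd f y hy]
  have hwb : ∀ y ∈ Cube.boundary (Fin k), ∀ u, w y u = e := by
    intro y hy u; simp [w, hχb y hy, loop_bd f y hy]
  let h1 : Ω^ (Fin k) Sph e := mkLoop (fun y => nrm (w y 1) (hw0 y 1))
    (nrm_cont _ (hwc.comp (continuous_id.prodMk continuous_const)) _) (by
      intro y hy
      rw [nrm_congr (hwb y hy 1) _ (sph_ne_zero e), nrm_self])
  have hom1 : GenLoop.Homotopic f h1 := by
    refine hom_of (fun y u => nrm (w y u) (hw0 y u)) (nrm_cont _ hwc _) ?_ ?_ ?_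
    · intro y
      have : w y 0 = (f y : Sph) := by simp [w]
      rw [nrm_congr this _ (sph_ne_zero _), nrm_self]
    · intro y; rfl
    · intro y hy u
      rw [nrm_congr (hwb y hy u) _ (sph_ne_zero e), nrm_self]
  let p : Sph := nrm q hq0
  have hqp : q = ‖q‖ • (p : E) := nrm_eq rfl
  have hpe : inner ℝ (p : E) (e : E) < 0 := by
    rw [hqp, real_inner_smul_left] at hqe'
    by_contra hcon
    have := mul_nonneg (norm_nonneg q) (not_lt.1 hcon)
    linarith
  have hep : e ≠ p := by
    intro h
    rw [← h, real_inner_self_eq_norm_sq, he1] at hpe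
    norm_num at hpe
  have hmiss : ∀ y, h1 y ≠ p := by
    intro y hy
    have hy' : w y 1 = ‖w y 1‖ • (p : E) := nrm_eq (h := hw0 y 1) hy
    have hwn : ‖w y 1‖ ≠ 0 := norm_ne_zero_iff.2 (hw0 y 1)
    rcases le_or_gt 1 ‖((f y : Sph) : E) - e‖ with hc | hc
    · have hχ : χ y = 1 := min_eq_left hc
      have hwg : w y 1 = G y := by simp [w, hχ]
      apply hq
      refine ⟨(fun i => (y i : ℝ), ‖q‖ / ‖w y 1‖), ?_⟩
      change (‖q‖ / ‖w y 1‖) • G y = q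
      rw [← hwg]
      conv_lhs => rw [hy']
      rw [smul_smul, norm_smul, sph_norm, norm_norm, mul_one, div_mul_cancel₀ _ hwn, ← hqp]
    · have h2 : inner ℝ ((f y : Sph) : E) (e : E) > 1/2 := by
        have h3 := norm_sub_sq_real ((f y : Sph) : E) (e : E)
        rw [sph_norm, he1] at h3
        nlinarith [norm_nonneg (((f y : Sph) : E) - e)]
      have h4 : inner ℝ (w y 1) (e : E) > 0 := by
        have h5 : inner ℝ (w y 1) (e : E) = inner ℝ ((f y : Sph) : E) (e : E) +
            inner ℝ (w y 1 - (f y : Sph)) (e : E) := by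
          rw [← inner_add_left]; simp
        have h6 := abs_real_inner_le_norm (w y 1 - (f y : Sph)) (e : E)
        rw [he1, mul_one] at h6
        have h7 := hwf y 1
        have h8 := abs_le.1 (h6.trans h7)
        linarith [h8.1]
      rw [hy', real_inner_smul_left] at h4
      have h9 := norm_nonneg (w y 1)
      nlinarith
  refine hom1.trans (hom_of (fun y u => sl p (h1 y) e u) ?_ ?_ ?_ ?_)
  · exact sl_cont p _ _ _ ((loop_cont h1).comp continuous_fst) continuous_const
      (by fun_prop) (fun k => hmiss _) (fun _ => hep)
  · intro y; simp [sl_zero p _ e (hmiss y)]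
  · intro y; simp [sl_one p _ e hep]
  · intro y hy u
    rw [loop_bd h1 y hy, sl_same p e _ hep]

theorem approx_cube2 {k : ℕ} (f : (I^(Fin k)) → I → E)
    (hf : Continuous fun p : (I^(Fin k)) × I => f p.1 p.2) {ε : ℝ} (hε : 0 < ε) :
    ∃ g : (Fin k → ℝ) × ℝ → E, ContDiff ℝ 1 g ∧
      ∀ (y : I^(Fin k)) (t : I), ‖g (fun i => (y i : ℝ), (t : ℝ)) - f y t‖ < ε := by
  let f' : (Fin k → ℝ) × ℝ → E := fun x => f (fun i => Set.projIcc (0:ℝ) 1 zero_le_one (x.1 i))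
    (Set.projIcc (0:ℝ) 1 zero_le_one x.2)
  have hpr : Continuous (Set.projIcc (0:ℝ) 1 zero_le_one) := continuous_projIcc
  have hf' : Continuous f' := hf.comp (Continuous.prodMk (continuous_pi fun i =>
    hpr.comp ((continuous_apply i).comp continuous_fst)) (hpr.comp continuous_snd))
  obtain ⟨g, hg, hgd, -⟩ := hf'.exists_contDiff_approx 1 (ε := fun _ => ε) continuous_const
    (fun _ => hε)
  refine ⟨g, hg, fun y t => ?_⟩
  have := hgd (fun i => (y i : ℝ), (t : ℝ))
  rw [dist_eq_norm] at this
  simpa [f'] using this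

/-- general position for families of paths: never hitting both `α` and `β` -/
theorem general_position {k : ℕ} (hk : k + 4 < 2 * Module.finrank ℝ E) (α β e : Sph)
    (hαβ : α ≠ β) (hαe : α ≠ e) (hβe : β ≠ e)
    (f : (I^(Fin k)) → I → Sph) (hf : Continuous fun p : (I^(Fin k)) × I => f p.1 p.2)
    {ε : ℝ} (hε : 0 < ε) :
    ∃ H : I → (I^(Fin k)) → I → Sph,
      (Continuous fun p : I × (I^(Fin k)) × I => H p.1 p.2.1 p.2.2) ∧
      (∀ s t, H 0 s t = f s t) ∧
      (∀ u s t, f s t = e → H u s t = e) ∧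
      (∀ u s t, dist (H u s t) (f s t) < ε) ∧
      (∀ s t t', H 1 s t = α → H 1 s t' = β → False) := by
  -- the radius
  obtain ⟨r, hr, hr1, hr2, hr3⟩ : ∃ r > 0, 4 * r ≤ dist α β ∧ 2 * r ≤ dist e α ∧ 2 * r ≤ dist e β := by
    refine ⟨min (dist α β / 4) (min (dist e α / 2) (dist e β / 2)), ?_, ?_, ?_, ?_⟩
    · have := dist_pos.2 hαβ; have := dist_pos.2 hαe.symm; have := dist_pos.2 hβe.symm
      positivity
    · have := min_le_left (dist α β / 4) (min (dist e α / 2) (dist e β / 2)); linarith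
    · have := min_le_right (dist α β / 4) (min (dist e α / 2) (dist e β / 2))
      have := min_le_left (dist e α / 2) (dist e β / 2); linarith
    · have := min_le_right (dist α β / 4) (min (dist e α / 2) (dist e β / 2))
      have := min_le_right (dist e α / 2) (dist e β / 2); linarith
  obtain ⟨η, hη, hη1, hη2, hη3⟩ : ∃ η > 0, 8 * η < ε ∧ 8 * η < r ∧ 8 * η < 1 := by
    refine ⟨min ε (min r 1) / 9, by positivity, ?_, ?_, ?_⟩
    · have := min_le_left ε (min r 1); linarith
    · have := min_le_right ε (min r 1); have := min_le_left r 1; linarith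
    · have := min_le_right ε (min r 1); have := min_le_right r 1; linarith
  have hfc : Continuous fun p : (I^(Fin k)) × I => ((f p.1 p.2 : Sph) : E) :=
    continuous_subtype_val.comp hf
  obtain ⟨g, hg, hgf⟩ := approx_cube2 (fun s t => ((f s t : Sph) : E)) hfc hη
  have hdense : Dense (Set.range fun q : (((Fin k → ℝ) × ℝ) × ℝ) × (ℝ × ℝ) =>
      (g q.1.1 - q.2.1 • (α : E), g (q.1.1.1, q.1.2) - q.2.2 • (β : E)))ᶜ := by
    refine ContDiff.dense_compl_range_of_finrank_lt_finrank ?_ ?_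
    · fun_prop
    · simp only [Module.finrank_prod, Module.finrank_fintype_fun_eq_card, Fintype.card_fin,
        Module.finrank_self]
      omega
  obtain ⟨⟨v, w⟩, hvw, hd⟩ := hdense.exists_dist_lt (0 : E × E) hη
  have hv : ‖v‖ < η := by
    rw [dist_comm, dist_zero_right, Prod.norm_def] at hd
    exact (le_max_left _ _).trans_lt hd
  have hw : ‖w‖ < η := by
    rw [dist_comm, dist_zero_right, Prod.norm_def] at hd
    exact (le_max_right _ _).trans_lt hd
  let χ : Sph → Sph → ℝ := fun c x => max 0 (min 1 (2 - dist x c / r))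
  have hχc : ∀ c, Continuous (χ c) := fun c => by fun_prop
  have hχ0 : ∀ c x, 0 ≤ χ c x := fun c x => le_max_left _ _
  have hχ1 : ∀ c x, χ c x ≤ 1 := fun c x => max_le zero_le_one (min_le_left _ _)
  have hχn : ∀ c x, dist x c ≤ r → χ c x = 1 := by
    intro c x h
    have : dist x c / r ≤ 1 := (div_le_one hr).2 h
    simp only [χ]
    rw [min_eq_left (by linarith), max_eq_right zero_le_one]
  have hχf : ∀ c x, 2 * r ≤ dist x c → χ c x = 0 := by
    intro c x h
    have : 2 ≤ dist x c / r := (le_div_iff₀ hr).2 h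
    simp only [χ]
    rw [max_eq_left]
    exact (min_le_right _ _).trans (by linarith)
  let G : (I^(Fin k)) → I → E := fun s t => g (fun i => (s i : ℝ), (t : ℝ))
  have hGc : Continuous fun p : (I^(Fin k)) × I => G p.1 p.2 := hg.continuous.comp (by fun_prop)
  let W : I → (I^(Fin k)) → I → E := fun u s t => (f s t : Sph) +
    ((u : ℝ) * χ α (f s t)) • (G s t - v - (f s t : Sph)) +
    ((u : ℝ) * χ β (f s t)) • (G s t - w - (f s t : Sph))
  have hWc : Continuous fun p : I × (I^(Fin k)) × I => W p.1 p.2.1 p.2.2 := by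
    have h1 : Continuous fun p : I × (I^(Fin k)) × I => f p.2.1 p.2.2 := hf.comp continuous_snd
    have h2 : Continuous fun p : I × (I^(Fin k)) × I => ((f p.2.1 p.2.2 : Sph) : E) :=
      hfc.comp continuous_snd
    have h3 : Continuous fun p : I × (I^(Fin k)) × I => G p.2.1 p.2.2 := hGc.comp continuous_snd
    have h4 : ∀ c, Continuous fun p : I × (I^(Fin k)) × I => χ c (f p.2.1 p.2.2) :=
      fun c => (hχc c).comp h1
    have h5 : Continuous fun p : I × (I^(Fin k)) × I => (p.1 : ℝ) := by fun_prop
    exact (h2.add ((h5.mul (h4 α)).smul ((h3.sub continuous_const).sub h2))).add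
      ((h5.mul (h4 β)).smul ((h3.sub continuous_const).sub h2))
  have hWf : ∀ u s t, ‖W u s t - (f s t : Sph)‖ ≤ 4 * η := by
    intro u s t
    have key : ∀ c : Sph, ∀ z : E, ‖z‖ < η →
        ‖((u : ℝ) * χ c (f s t)) • (G s t - z - (f s t : Sph))‖ ≤ 2 * η := by
      intro c z hz
      rw [norm_smul, Real.norm_eq_abs, abs_of_nonneg (mul_nonneg u.2.1 (hχ0 _ _))]
      have h1 : (u : ℝ) * χ c (f s t) ≤ 1 := mul_le_one₀ u.2.2 (hχ0 _ _) (hχ1 _ _)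
      have h2 : ‖G s t - z - (f s t : Sph)‖ ≤ 2 * η := by
        have : G s t - z - (f s t : Sph) = (G s t - (f s t : Sph)) - z := by abel
        rw [this]
        have := norm_sub_le (G s t - (f s t : Sph)) z
        have := (hgf s t).le
        linarith
      calc _ ≤ 1 * ‖G s t - z - (f s t : Sph)‖ := by gcongr
        _ ≤ _ := by linarith
    have h1 : W u s t - (f s t : Sph) = ((u : ℝ) * χ α (f s t)) • (G s t - v - (f s t : Sph)) +
      ((u : ℝ) * χ β (f s t)) • (G s t - w - (f s t : Sph)) := by simp only [W]; abel
    rw [h1]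
    have := norm_add_le (((u : ℝ) * χ α (f s t)) • (G s t - v - (f s t : Sph)))
      (((u : ℝ) * χ β (f s t)) • (G s t - w - (f s t : Sph)))
    have := key α v hv
    have := key β w hw
    linarith
  have hW0 : ∀ u s t, W u s t ≠ 0 := by
    intro u s t h
    have := hWf u s t
    rw [h, zero_sub, norm_neg, sph_norm] at this
    linarith
  have hdist : ∀ u s t, dist (nrm (W u s t) (hW0 u s t)) (f s t) ≤ 8 * η := by
    intro u s t
    rw [Subtype.dist_eq, dist_eq_norm]
    have := norm_nrm_sub (f s t) (W u s t) (hW0 u s t)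
    have := hWf u s t
    linarith
  refine ⟨fun u s t => nrm (W u s t) (hW0 u s t), nrm_cont _ hWc _, ?_, ?_, ?_, ?_⟩
  · intro s t
    have : W 0 s t = (f s t : Sph) := by simp [W]
    beta_reduce
    rw [nrm_congr this _ (sph_ne_zero _), nrm_self]
  · intro u s t h
    have : W u s t = e := by
      simp only [W, h, hχf α e hr2, hχf β e hr3]; simp
    beta_reduce
    rw [nrm_congr this _ (sph_ne_zero _), nrm_self]
  · intro u s t
    exact (hdist u s t).trans_lt hη1
  · intro s t t' h1 h2
    beta_reduce at h1 h2
    have d1 := hdist 1 s t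
    have d2 := hdist 1 s t'
    rw [h1, dist_comm] at d1
    rw [h2, dist_comm] at d2
    have a1 : χ α (f s t) = 1 := hχn _ _ (by linarith)
    have a2 : χ β (f s t) = 0 := hχf _ _ (by
      have := dist_triangle_left α β (f s t); linarith)
    have b1 : χ β (f s t') = 1 := hχn _ _ (by linarith)
    have b2 : χ α (f s t') = 0 := hχf _ _ (by
      have := dist_triangle_left α β (f s t'); linarith)
    have w1 := nrm_eq (h := hW0 1 s t) h1
    have w2 := nrm_eq (h := hW0 1 s t') h2
    have W1 : W 1 s t = G s t - v := by simp [W, a1, a2]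
    have W2 : W 1 s t' = G s t' - w := by simp [W, b1, b2]
    apply hvw
    refine ⟨((((fun i => (s i : ℝ)), (t : ℝ)), (t' : ℝ)), (‖W 1 s t‖, ‖W 1 s t'‖)), ?_⟩
    change (G s t - ‖W 1 s t‖ • (α : E), G s t' - ‖W 1 s t'‖ • (β : E)) = (v, w)
    rw [← w1, ← w2, W1, W2]
    simp

end PartC

section PartD

open unitInterval Topology.Homotopy

theorem transAt_congr {N X : Type} [TopologicalSpace X] [DecidableEq N] [Nonempty N] {x : X} (i : N)
    {f f' g g' : Ω^ N X x} (hf : GenLoop.Homotopic f f') (hg : GenLoop.Homotopic g g') :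
    GenLoop.Homotopic (GenLoop.transAt i f g) (GenLoop.transAt i f' g') := by
  have e1 := HomotopyGroup.mul_spec (i := i) (p := g) (q := f)
  have e2 := HomotopyGroup.mul_spec (i := i) (p := g') (q := f')
  have q1 : (⟦f⟧ : HomotopyGroup N X x) = ⟦f'⟧ := Quotient.sound hf
  have q2 : (⟦g⟧ : HomotopyGroup N X x) = ⟦g'⟧ := Quotient.sound hg
  rw [q1, q2] at e1
  exact Quotient.exact (e1.symm.trans e2)

/-- projection to the unit interval -/
def pj (t : ℝ) : I := Set.projIcc 0 1 zero_le_one t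

theorem pj_cont : Continuous pj := continuous_projIcc (h := zero_le_one)

theorem pj_coe (t : I) : pj t = t := by simp [pj]

theorem pj_of {t : ℝ} (h0 : 0 ≤ t) (h1 : t ≤ 1) : ((pj t : I) : ℝ) = t := by
  unfold pj; rw [Set.projIcc_of_mem _ ⟨h0, h1⟩]

theorem pj_le {t : ℝ} {c : I} (h : t ≤ c) : pj t ≤ c := by
  rw [← pj_coe c]; exact Set.monotone_projIcc _ h

theorem le_pj {t : ℝ} {c : I} (h : (c : ℝ) ≤ t) : c ≤ pj t := by
  rw [← pj_coe c]; exact Set.monotone_projIcc _ h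

theorem pj_zero : pj 0 = 0 := by simpa using pj_coe 0
theorem pj_one : pj 1 = 1 := by simpa using pj_coe 1

variable {E : Type} [NormedAddCommGroup E] [InnerProductSpace ℝ E] [FiniteDimensional ℝ E]

local notation "Sph" => Metric.sphere (0 : E) 1

/-- a time `ζ` separating the visits of `α` from those of `β` -/
def Valid {K : Type} (α β : Sph) (h : K → I → Sph) (ζ : K → I) : Prop :=
  ∀ s t, (t ≤ ζ s → h s t ≠ β) ∧ (ζ s ≤ t → h s t ≠ α)

theorem exists_valid {K : Type} [TopologicalSpace K] [CompactSpace K] [T2Space K] (α β : Sph)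
    (h : K → I → Sph) (hc : Continuous fun p : K × I => h p.1 p.2)
    (h0 : ∀ s, h s 0 ≠ β) (h1 : ∀ s, h s 1 ≠ α)
    (hg : ∀ s t t', h s t = α → h s t' = β → False) :
    ∃ ζ : K → I, Continuous ζ ∧ Valid α β h ζ := by
  let T : K → Set ℝ := fun s => {c | (0 ≤ c ∧ c ≤ 1) ∧ ∀ t : I, ((t : ℝ) ≤ c → h s t ≠ β) ∧
    (c ≤ t → h s t ≠ α)}
  have hconv : ∀ s, Convex ℝ (T s) := by
    intro s
    rw [convex_iff_ordConnected]
    refine ⟨?_⟩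
    rintro a ⟨⟨ha0, ha1⟩, ha⟩ b ⟨⟨hb0, hb1⟩, hb⟩ c ⟨hac, hcb⟩
    exact ⟨⟨ha0.trans hac, hcb.trans hb1⟩, fun t => ⟨fun ht => (hb t).1 (ht.trans hcb),
      fun ht => (ha t).2 (hac.trans ht)⟩⟩
  have hloc : ∀ s, ∃ c : ℝ, ∀ᶠ y in 𝓝 s, c ∈ T y := by
    intro s
    have hex : ∃ c : ℝ, c ∈ T s := by
      by_cases hα : ∃ t, h s t = α
      · obtain ⟨t0, ht0⟩ := hα
        refine ⟨1, ⟨zero_le_one, le_rfl⟩, fun t => ⟨fun _ ht => hg s t0 t ht0 ht, fun ht => ?_⟩⟩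
        have : t = 1 := le_antisymm t.2.2 ht
        rw [this]; exact h1 s
      · refine ⟨0, ⟨le_rfl, zero_le_one⟩, fun t => ⟨fun ht => ?_, fun _ ht => hα ⟨t, ht⟩⟩⟩
        have : t = 0 := le_antisymm ht t.2.1
        rw [this]; exact h0 s
    obtain ⟨c, hc01, hcT⟩ := hex
    refine ⟨c, ?_⟩
    have e1 : ∀ᶠ y in 𝓝 s, ∀ t ∈ {t : I | (t : ℝ) ≤ c}, h y t ≠ β := by
      refine IsCompact.eventually_forall_of_forall_eventually
        (isClosed_le (by fun_prop) (by fun_prop)).isCompact ?_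
      intro t ht
      exact hc.continuousAt.eventually_ne ((hcT t).1 ht)
    have e2 : ∀ᶠ y in 𝓝 s, ∀ t ∈ {t : I | c ≤ (t : ℝ)}, h y t ≠ α := by
      refine IsCompact.eventually_forall_of_forall_eventually
        (isClosed_le (by fun_prop) (by fun_prop)).isCompact ?_
      intro t ht
      exact hc.continuousAt.eventually_ne ((hcT t).2 ht)
    filter_upwards [e1, e2] with y h1 h2
    exact ⟨hc01, fun t => ⟨h1 t, h2 t⟩⟩
  obtain ⟨g, hgT⟩ := exists_continuous_forall_mem_convex_of_local_const hconv hloc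
  refine ⟨fun s => ⟨g s, (hgT s).1⟩, by fun_prop, fun s t => ?_⟩
  exact (hgT s).2 t

theorem valid_stable {K : Type} [TopologicalSpace K] [CompactSpace K] (α β : Sph)
    (h : K → I → Sph) (hc : Continuous fun p : K × I => h p.1 p.2) (ζ : K → I) (hζ : Continuous ζ)
    (hv : Valid α β h ζ) : ∃ ε > 0, ∀ s t (x : Sph), dist x (h s t) < ε →
      (t ≤ ζ s → x ≠ β) ∧ (ζ s ≤ t → x ≠ α) := by
  have key : ∀ (c : Sph) (C : Set (K × I)), IsClosed C → (∀ p ∈ C, h p.1 p.2 ≠ c) →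
      ∃ ε > 0, ∀ p ∈ C, ε ≤ dist c (h p.1 p.2) := by
    intro c C hC hh
    have h1 : IsClosed ((fun p : K × I => h p.1 p.2) '' C) := (hC.isCompact.image hc).isClosed
    have h2 : c ∉ (fun p : K × I => h p.1 p.2) '' C := by
      rintro ⟨p, hp, e⟩; exact hh p hp e
    obtain ⟨ε, hε, hb⟩ := Metric.isOpen_iff.1 h1.isOpen_compl c h2
    refine ⟨ε, hε, fun p hp => ?_⟩
    by_contra hcon
    exact hb (Metric.mem_ball'.2 (not_le.1 hcon)) ⟨p, hp, rfl⟩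
  obtain ⟨ε1, hε1, k1⟩ := key β {p | p.2 ≤ ζ p.1}
    (isClosed_le continuous_snd (hζ.comp continuous_fst)) (fun p hp => (hv p.1 p.2).1 hp)
  obtain ⟨ε2, hε2, k2⟩ := key α {p | ζ p.1 ≤ p.2}
    (isClosed_le (hζ.comp continuous_fst) continuous_snd) (fun p hp => (hv p.1 p.2).2 hp)
  refine ⟨min ε1 ε2, lt_min hε1 hε2, fun s t x hx => ⟨fun ht e => ?_, fun ht e => ?_⟩⟩
  · have := k1 (s, t) ht
    rw [← e] at this
    exact absurd (hx.trans_le (min_le_left _ _)) (not_lt.2 this)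
  · have := k2 (s, t) ht
    rw [← e] at this
    exact absurd (hx.trans_le (min_le_right _ _)) (not_lt.2 this)

/-- straight interpolation in the interval -/
def lerp (a b u : I) : I := pj ((1 - (u : ℝ)) * a + u * b)

theorem lerp_zero (a b : I) : lerp a b 0 = a := by simp [lerp, pj_coe]
theorem lerp_one (a b : I) : lerp a b 1 = b := by simp [lerp, pj_coe]
theorem lerp_cont {K : Type} [TopologicalSpace K] {a b u : K → I} (ha : Continuous a)
    (hb : Continuous b) (hu : Continuous u) : Continuous fun k => lerp (a k) (b k) (u k) :=
  pj_cont.comp (by fun_prop)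
theorem lerp_same (a u : I) : lerp a a u = a := by
  unfold lerp
  have : (1 - (u : ℝ)) * a + u * a = a := by ring
  rw [this, pj_coe]

theorem lerp_le {a b c : I} (ha : a ≤ c) (hb : b ≤ c) (u : I) : lerp a b u ≤ c := by
  apply pj_le
  have h1 : (a : ℝ) ≤ c := ha
  have h2 : (b : ℝ) ≤ c := hb
  have := u.2.1; have := u.2.2
  nlinarith

theorem le_lerp {a b c : I} (ha : c ≤ a) (hb : c ≤ b) (u : I) : c ≤ lerp a b u := by
  apply le_pj
  have h1 : (c : ℝ) ≤ a := ha
  have h2 : (c : ℝ) ≤ b := hb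
  have := u.2.1; have := u.2.2
  nlinarith

theorem valid_lerp {K : Type} (α β : Sph) (h : K → I → Sph) (ζ τ : K → I)
    (hζ : Valid α β h ζ) (hτ : Valid α β h τ) (u : I) : Valid α β h fun s => lerp (ζ s) (τ s) u := by
  intro s t
  rcases le_total (ζ s) (τ s) with hst | hst
  · exact ⟨fun ht => (hτ s t).1 (ht.trans (lerp_le hst le_rfl u)),
      fun ht => (hζ s t).2 ((le_lerp le_rfl hst u).trans ht)⟩
  · exact ⟨fun ht => (hζ s t).1 (ht.trans (lerp_le le_rfl hst u)),
      fun ht => (hτ s t).2 ((le_lerp hst le_rfl u).trans ht)⟩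

/-- sphere without two points -/
abbrev YY (α β : Sph) : Type := {y : Sph // y ≠ α ∧ y ≠ β}

theorem valid_mem {K : Type} {α β : Sph} {h : K → I → Sph} {ζ : K → I} (hv : Valid α β h ζ) (s : K) :
    h s (ζ s) ≠ α ∧ h s (ζ s) ≠ β := ⟨(hv s _).2 le_rfl, (hv s _).1 le_rfl⟩

/-- the meridian loop through a point -/
def merid (α β e y : Sph) (t : I) : Sph :=
  if (t : ℝ) ≤ 1 / 2 then sl β e y (2 * t) else sl α y e (2 * t - 1)

theorem merid_cont {K : Type} [TopologicalSpace K] {α β e : Sph} (hα : e ≠ α) (hβ : e ≠ β)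
    (y : K → Sph) (hy : Continuous y) (hyα : ∀ k, y k ≠ α) (hyβ : ∀ k, y k ≠ β)
    (t : K → I) (ht : Continuous t) : Continuous fun k => merid α β e (y k) (t k) := by
  unfold merid
  refine Continuous.if_le ?_ ?_ (by fun_prop) continuous_const ?_
  · exact sl_cont _ _ _ _ continuous_const hy (by fun_prop) (fun _ => hβ) hyβ
  · exact sl_cont _ _ _ _ hy continuous_const (by fun_prop) hyα (fun _ => hα)
  · intro k hk
    have h1 : 2 * (t k : ℝ) = 1 := by rw [hk]; norm_num
    have h2 : 2 * (t k : ℝ) - 1 = 0 := by rw [h1]; norm_num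
    rw [h1, sub_self, sl_one _ _ _ (hyβ k), sl_zero _ _ _ (hyα k)]

theorem merid_zero {α β e : Sph} (hβ : e ≠ β) (y : Sph) : merid α β e y 0 = e := by
  simp [merid, sl_zero _ _ _ hβ]

theorem merid_one {α β e : Sph} (hα : e ≠ α) (y : Sph) : merid α β e y 1 = e := by
  have : ¬ ((1 : ℝ) ≤ 1 / 2) := by norm_num
  have h2 : (2 : ℝ) * 1 - 1 = 1 := by norm_num
  simp only [merid, Set.Icc.coe_one, this, if_false, h2, sl_one _ _ _ hα]

theorem merid_base {α β e : Sph} (hα : e ≠ α) (hβ : e ≠ β) (t : I) : merid α β e e t = e := by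
  simp [merid, sl_same _ _ _ hα, sl_same _ _ _ hβ]

/-- midpoint of the interval -/
def mdp : I := ⟨1/2, by norm_num, by norm_num⟩

theorem merid_mid {α β e : Sph} (y : Sph) (hy : y ≠ β) : merid α β e y mdp = y := by
  have : (2 : ℝ) * (1/2) = 1 := by norm_num
  simp only [merid, mdp, le_refl, if_true, this, sl_one _ _ _ hy]

theorem merid_valid {K : Type} {α β e : Sph} (y : K → Sph) (hy : ∀ k, y k ≠ α)
    (hyβ : ∀ k, y k ≠ β) :
    Valid α β (fun k => merid α β e (y k)) (fun _ => mdp) := by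
  intro s t
  refine ⟨fun ht => ?_, fun ht => ?_⟩
  · have : (t : ℝ) ≤ 1 / 2 := ht
    simp only [merid, this, if_true]; exact sl_ne _ _ _ _
  · have h1 : (1 / 2 : ℝ) ≤ t := ht
    rcases h1.lt_or_eq with h2 | h2
    · simp only [merid, not_le.2 h2, if_false]; exact sl_ne _ _ _ _
    · simp only [merid, ← h2, le_refl, if_true]
      have : (2 : ℝ) * (1/2) = 1 := by norm_num
      rw [this]
      rw [sl_one _ _ _ (hyβ s)]; exact hy s

section Susp

variable {α β e : Metric.sphere (0 : E) 1} (hα : e ≠ α) (hβ : e ≠ β)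

/-- suspension of a loop -/
def SM {k : ℕ} (a : Ω^ (Fin k) (YY (E := E) α β) ⟨e, hα, hβ⟩) : Ω^ (Fin (k+1)) Sph e :=
  famLoop (fun s t => merid α β e (a s).1 t)
    (merid_cont hα hβ _ (continuous_subtype_val.comp ((loop_cont a).comp continuous_fst))
      (fun p => (a p.1).2.1) (fun p => (a p.1).2.2) _ continuous_snd)
    (fun s => merid_zero hβ _) (fun s => merid_one hα _)
    (fun s hs t => by rw [loop_bd a s hs]; exact merid_base hα hβ t)

theorem SM_apply {k : ℕ} (a : Ω^ (Fin k) (YY (E := E) α β) ⟨e, hα, hβ⟩) (y) :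
    SM hα hβ a y = merid α β e (a (Fin.tail y)).1 (y 0) := rfl

theorem SM_hom {k : ℕ} {a b : Ω^ (Fin k) (YY (E := E) α β) ⟨e, hα, hβ⟩} (h : GenLoop.Homotopic a b) :
    GenLoop.Homotopic (SM hα hβ a) (SM hα hβ b) := by
  obtain ⟨H, hc, h0, h1, hb⟩ := of_hom h
  refine hom_of (fun y u => merid α β e (H (Fin.tail y) u).1 (y 0)) ?_ ?_ ?_ ?_
  · refine merid_cont hα hβ (fun p : (I^(Fin (k+1))) × I => (H (Fin.tail p.1) p.2).1) ?_
      (fun p => (H _ _).2.1) (fun p => (H _ _).2.2) (fun p => p.1 0) (by fun_prop)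
    exact continuous_subtype_val.comp (hc.comp ((continuous_tail.comp continuous_fst).prodMk
      continuous_snd))
  · intro y; rw [h0]; rfl
  · intro y; rw [h1]; rfl
  · intro y hy u
    rcases cons_boundary.1 hy with h | h | h
    · rw [h]; exact merid_zero hβ _
    · rw [h]; exact merid_one hα _
    · rw [hb _ h]; exact merid_base hα hβ _

theorem SM_transAt {k : ℕ} (j : Fin k) (a b : Ω^ (Fin k) (YY (E := E) α β) ⟨e, hα, hβ⟩) :
    SM hα hβ (GenLoop.transAt j a b) = GenLoop.transAt j.succ (SM hα hβ a) (SM hα hβ b) := by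
  ext1 y
  rw [← unfam_tail (GenLoop.transAt j.succ (SM hα hβ a) (SM hα hβ b)) y, unfam_transAt,
    SM_apply, transAt_cat]
  rw [catFun_map (fun z : YY (E := E) α β => merid α β e z.1 (y 0))]
  rfl

/-- reparametrisation adapted to `c` -/
def rep (c t : I) : I := if (t : ℝ) ≤ 1 / 2 then pj (2 * t * c) else pj (c + (2 * t - 1) * (1 - c))

theorem rep_lo {c t : I} (h : (t : ℝ) ≤ 1 / 2) : rep c t ≤ c := by
  rw [rep, if_pos h]
  apply pj_le
  have := c.2.1
  nlinarith

theorem rep_hi {c t : I} (h : (1 / 2 : ℝ) ≤ t) : c ≤ rep c t := by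
  rcases h.lt_or_eq with h2 | h2
  · rw [rep, if_neg (not_le.2 h2)]
    apply le_pj
    have := c.2.2
    nlinarith
  · rw [rep, if_pos h2.ge]
    apply le_pj
    rw [← h2]; linarith

theorem rep_zero (c : I) : rep c 0 = 0 := by simp [rep, pj_zero]
theorem rep_one (c : I) : rep c 1 = 1 := by
  have : ¬ ((1 : ℝ) ≤ 1 / 2) := by norm_num
  have h2 : (c : ℝ) + (2 * 1 - 1) * (1 - c) = 1 := by ring
  simp only [rep, Set.Icc.coe_one, this, if_false, h2, pj_one]

theorem rep_mid (c t : I) (h : (t : ℝ) = 1 / 2) : rep c t = c :=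
  le_antisymm (rep_lo h.le) (rep_hi h.ge)

theorem rep_cont {K : Type} [TopologicalSpace K] {c t : K → I} (hc : Continuous c)
    (ht : Continuous t) : Continuous fun k => rep (c k) (t k) := by
  unfold rep
  refine Continuous.if_le (pj_cont.comp (by fun_prop)) (pj_cont.comp (by fun_prop)) (by fun_prop)
    continuous_const ?_
  intro k hk
  rw [hk]; congr 1; ring

/-- a loop which is a good family is a suspension -/
theorem SM_surj_aux {k : ℕ} (f : Ω^ (Fin (k+1)) Sph e) (ζ : (I^(Fin k)) → I) (hζ : Continuous ζ)
    (hv : Valid α β (unfam f) ζ) :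
    ∃ a : Ω^ (Fin k) (YY (E := E) α β) ⟨e, hα, hβ⟩, GenLoop.Homotopic (SM hα hβ a) f := by
  have hcy : Continuous fun s => unfam f s (ζ s) := (unfam_cont f).comp (continuous_id.prodMk hζ)
  let a : Ω^ (Fin k) (YY (E := E) α β) ⟨e, hα, hβ⟩ := mkLoop (fun s => ⟨unfam f s (ζ s), valid_mem hv s⟩)
    (hcy.subtype_mk _) (fun s hs => Subtype.ext (unfam_bd f s hs _))
  refine ⟨a, ?_⟩
  -- the reparametrised loop
  let F1 : (I^(Fin k)) → I → Sph := fun s t => unfam f s (rep (ζ s) t)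
  have hF1 : Continuous fun p : (I^(Fin k)) × I => F1 p.1 p.2 := (unfam_cont f).comp
    (continuous_fst.prodMk (rep_cont (hζ.comp continuous_fst) continuous_snd))
  let f1 : Ω^ (Fin (k+1)) Sph e := famLoop F1 hF1 (fun s => by simp [F1, rep_zero, unfam_zero])
    (fun s => by simp [F1, rep_one, unfam_one]) (fun s hs t => unfam_bd f s hs _)
  have hom1 : GenLoop.Homotopic f f1 := by
    refine hom_of (fun y u => unfam f (Fin.tail y) (lerp (y 0) (rep (ζ (Fin.tail y)) (y 0)) u))
      ?_ ?_ ?_ ?_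
    · have h1 : Continuous fun p : (I^(Fin (k+1))) × I => (Fin.tail p.1 : I^(Fin k)) :=
        continuous_tail.comp continuous_fst
      have h2 : Continuous fun p : (I^(Fin (k+1))) × I => p.1 0 := by fun_prop
      exact (unfam_cont f).comp (h1.prodMk (lerp_cont h2 (rep_cont (hζ.comp h1) h2)
        continuous_snd))
    · intro y; rw [lerp_zero, unfam_tail]
    · intro y; rw [lerp_one]; rfl
    · intro y hy u
      rcases cons_boundary.1 hy with h | h | h
      · rw [h, rep_zero, lerp_same, unfam_zero]
      · rw [h, rep_one, lerp_same, unfam_one]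
      · rw [unfam_bd f _ h]
  have hlo : ∀ s (t : I), (t : ℝ) ≤ 1 / 2 → F1 s t ≠ β := fun s t ht => (hv s _).1 (rep_lo ht)
  have hhi : ∀ s (t : I), (1 / 2 : ℝ) ≤ t → F1 s t ≠ α := fun s t ht => (hv s _).2 (rep_hi ht)
  have hom2 : GenLoop.Homotopic f1 (SM hα hβ a) := by
    let lo : I → I := fun t => min t mdp
    let hi : I → I := fun t => max t mdp
    have hlo' : ∀ t, ((lo t : I) : ℝ) ≤ 1 / 2 := fun t => (min_le_right t mdp : lo t ≤ mdp)
    have hhi' : ∀ t, (1 / 2 : ℝ) ≤ (hi t : I) := fun t => (le_max_right t mdp : mdp ≤ hi t)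
    let H : (I^(Fin (k+1))) → I → Sph := fun y u => if ((y 0 : I) : ℝ) ≤ 1 / 2
      then sl β (F1 (Fin.tail y) (lo (y 0))) (sl β e (a (Fin.tail y)).1 (2 * (y 0 : I))) u
      else sl α (F1 (Fin.tail y) (hi (y 0))) (sl α (a (Fin.tail y)).1 e (2 * (y 0 : I) - 1)) u
    have hmidF : ∀ s (t : I), (t : ℝ) = 1 / 2 → F1 s t = (a s).1 := by
      intro s t ht
      simp only [F1, rep_mid _ _ ht]; rfl
    refine hom_of H ?_ ?_ ?_ ?_
    · have h1 : Continuous fun p : (I^(Fin (k+1))) × I => (Fin.tail p.1 : I^(Fin k)) :=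
        continuous_tail.comp continuous_fst
      have h2 : Continuous fun p : (I^(Fin (k+1))) × I => p.1 0 := by fun_prop
      have ha : Continuous fun p : (I^(Fin (k+1))) × I => (a (Fin.tail p.1)).1 :=
        continuous_subtype_val.comp ((loop_cont a).comp h1)
      have hl : Continuous lo := by fun_prop
      have hh : Continuous hi := by fun_prop
      refine Continuous.if_le ?_ ?_ (by fun_prop) continuous_const ?_
      · refine sl_cont _ _ _ _ (hF1.comp (h1.prodMk (hl.comp h2))) ?_ (by fun_prop)
          (fun p => hlo _ _ (hlo' _)) (fun p => sl_ne _ _ _ _)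
        exact sl_cont _ _ _ _ continuous_const ha (by fun_prop) (fun _ => hβ)
          (fun p => (a _).2.2)
      · refine sl_cont _ _ _ _ (hF1.comp (h1.prodMk (hh.comp h2))) ?_ (by fun_prop)
          (fun p => hhi _ _ (hhi' _)) (fun p => sl_ne _ _ _ _)
        exact sl_cont _ _ _ _ ha continuous_const (by fun_prop) (fun p => (a _).2.1)
          (fun _ => hα)
      · intro p hp
        have e1 : lo (p.1 0) = p.1 0 := min_eq_left (show p.1 0 ≤ mdp from hp.le)
        have e2 : hi (p.1 0) = p.1 0 := max_eq_left (show mdp ≤ p.1 0 from hp.ge)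
        have e3 : 2 * ((p.1 0 : I) : ℝ) = 1 := by rw [hp]; norm_num
        rw [e1, e2, e3, sub_self, sl_one _ _ _ (a _).2.2, sl_zero _ _ _ (a _).2.1,
          hmidF _ _ hp, sl_same _ _ _ (a _).2.2, sl_same _ _ _ (a _).2.1]
    · intro y
      change H y 0 = F1 (Fin.tail y) (y 0)
      simp only [H, Set.Icc.coe_zero]
      split_ifs with hp
      · have e1 : lo (y 0) = y 0 := min_eq_left (show y 0 ≤ mdp from hp)
        rw [sl_zero _ _ _ (hlo _ _ (hlo' _)), e1]
      · have e2 : hi (y 0) = y 0 := max_eq_left (show mdp ≤ y 0 from (not_le.1 hp).le)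
        rw [sl_zero _ _ _ (hhi _ _ (hhi' _)), e2]
    · intro y
      rw [SM_apply]
      simp only [H, merid, Set.Icc.coe_one]
      split_ifs with hp
      · rw [sl_one _ _ _ (sl_ne _ _ _ _)]
      · rw [sl_one _ _ _ (sl_ne _ _ _ _)]
    · intro y hy u
      simp only [H]
      rcases cons_boundary.1 hy with h | h | h
      · have e1 : lo 0 = 0 := min_eq_left (show (0 : I) ≤ mdp from mdp.2.1)
        have e3 : F1 (Fin.tail y) 0 = e := by simp [F1, rep_zero, unfam_zero]
        rw [h, e1, e3]
        simp [sl_zero _ _ _ hβ, sl_same _ _ _ hβ]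
      · have e1 : hi 1 = 1 := max_eq_left (show mdp ≤ (1 : I) from mdp.2.2)
        have e3 : F1 (Fin.tail y) 1 = e := by simp [F1, rep_one, unfam_one]
        have : ¬ ((1 : ℝ) ≤ 1 / 2) := by norm_num
        have h2 : (2 : ℝ) * 1 - 1 = 1 := by norm_num
        rw [h, e1, e3]
        simp only [Set.Icc.coe_one, this, if_false, h2, sl_one _ _ _ hα, sl_same _ _ _ hα]
      · have e3 : ∀ t, F1 (Fin.tail y) t = e := fun t => unfam_bd f _ h _
        rw [loop_bd a _ h, e3, e3]
        simp only [sl_same _ _ _ hα, sl_same _ _ _ hβ, ite_self]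
  exact (hom1.trans hom2).symm

theorem SM_ker {k : ℕ} (hk : k + 1 + 4 < 2 * Module.finrank ℝ E) (hαβ : α ≠ β)
    (a : Ω^ (Fin k) (YY (E := E) α β) ⟨e, hα, hβ⟩)
    (hn : GenLoop.Homotopic (SM hα hβ a) GenLoop.const) : GenLoop.Homotopic a GenLoop.const := by
  obtain ⟨F', hFc', hF0, hF1, hFb⟩ := of_hom hn
  have hac : Continuous fun s => (a s).1 := continuous_subtype_val.comp (loop_cont a)
  obtain ⟨ε, hε, hst⟩ := valid_stable α β (fun s => merid α β e (a s).1)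
    (merid_cont hα hβ _ (hac.comp continuous_fst)
      (fun p => (a p.1).2.1) (fun p => (a p.1).2.2) _ continuous_snd) (fun _ => mdp)
    continuous_const (merid_valid _ (fun s => (a s).2.1) (fun s => (a s).2.2))
  let F : (I^(Fin (k+1))) → I → Sph := fun q t => F' (Fin.cons t (Fin.tail q) : I^(Fin (k+1))) (q 0)
  have hF : Continuous fun p : (I^(Fin (k+1))) × I => F p.1 p.2 := by
    refine hFc'.comp (Continuous.prodMk ?_ (by fun_prop))
    exact continuous_cons.comp ((continuous_tail.comp continuous_fst).prodMk continuous_snd)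
  obtain ⟨H, hHc, hH0, hHe, hHd, hHg⟩ := general_position hk α β e hαβ hα.symm hβ.symm F hF hε
  have F_0 : ∀ s t, F (Fin.cons 0 s : I^(Fin (k+1))) t = merid α β e (a s).1 t := by
    intro s t
    simp only [F, Fin.cons_zero, Fin.tail_cons]
    rw [hF0, SM_apply]; simp
  have F_1 : ∀ s t, F (Fin.cons 1 s : I^(Fin (k+1))) t = e := by
    intro s t
    simp only [F, Fin.cons_zero, Fin.tail_cons]
    rw [hF1]; rfl
  have F_b : ∀ v, ∀ s ∈ Cube.boundary (Fin k), ∀ t, F (Fin.cons v s : I^(Fin (k+1))) t = e := by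
    intro v s hs t
    simp only [F, Fin.cons_zero, Fin.tail_cons]
    exact hFb _ (cons_boundary'.2 (Or.inr (Or.inr hs))) _
  have F_t0 : ∀ q, F q 0 = e := fun q => hFb _ (cons_boundary'.2 (Or.inl rfl)) _
  have F_t1 : ∀ q, F q 1 = e := fun q => hFb _ (cons_boundary'.2 (Or.inr (Or.inl rfl))) _
  obtain ⟨τ, hτc, hτ⟩ := exists_valid α β (H 1) (hHc.comp (continuous_const.prodMk continuous_id))
    (fun q => by rw [hHe _ _ _ (F_t0 q)]; exact hβ) (fun q => by rw [hHe _ _ _ (F_t1 q)]; exact hα)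
    hHg
  have hcons0 : Continuous fun s : I^(Fin k) => (Fin.cons 0 s : I^(Fin (k+1))) :=
    continuous_cons.comp (continuous_id.prodMk continuous_const)
  have hv0 : ∀ u, Valid α β (fun s => H u (Fin.cons 0 s : I^(Fin (k+1)))) (fun _ : I^(Fin k) => mdp) := by
    intro u s t
    refine hst s t _ ?_
    rw [← F_0]; exact hHd _ _ _
  have hv1 : Valid α β (fun s => H 1 (Fin.cons 0 s : I^(Fin (k+1))))
      (fun s : I^(Fin k) => τ (Fin.cons 0 s : I^(Fin (k+1)))) := fun s t => hτ _ t
  have hcH : ∀ {K : Type} [TopologicalSpace K] (u : K → I) (q : K → I^(Fin (k+1))) (t : K → I),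
      Continuous u → Continuous q → Continuous t → Continuous fun x => H (u x) (q x) (t x) :=
    fun u q t hu hq ht => hHc.comp (hu.prodMk (hq.prodMk ht))
  let b1 : Ω^ (Fin k) (YY (E := E) α β) ⟨e, hα, hβ⟩ := mkLoop
    (fun s => ⟨H 1 (Fin.cons 0 s : I^(Fin (k+1))) mdp, valid_mem (hv0 1) s⟩)
    ((hcH _ _ _ continuous_const hcons0 continuous_const).subtype_mk _)
    (fun s hs => Subtype.ext (hHe _ _ _ (F_b 0 s hs _)))
  let b2 : Ω^ (Fin k) (YY (E := E) α β) ⟨e, hα, hβ⟩ := mkLoop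
    (fun s => ⟨H 1 (Fin.cons 0 s : I^(Fin (k+1))) (τ (Fin.cons 0 s : I^(Fin (k+1)))), valid_mem hv1 s⟩)
    ((hcH _ _ _ continuous_const hcons0 (hτc.comp hcons0)).subtype_mk _)
    (fun s hs => Subtype.ext (hHe _ _ _ (F_b 0 s hs _)))
  have h1 : GenLoop.Homotopic a b1 := by
    refine hom_of (fun s u => ⟨H u (Fin.cons 0 s : I^(Fin (k+1))) mdp, valid_mem (hv0 u) s⟩)
      ?_ ?_ ?_ ?_
    · exact (hcH _ _ _ continuous_snd (hcons0.comp continuous_fst) continuous_const).subtype_mk _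
    · intro s; apply Subtype.ext
      change H 0 _ _ = _
      rw [hH0, F_0, merid_mid _ (a s).2.2]
    · intro s; rfl
    · intro s hs u; exact Subtype.ext (hHe _ _ _ (F_b 0 s hs _))
  have h2 : GenLoop.Homotopic b1 b2 := by
    refine hom_of (fun s u => ⟨H 1 (Fin.cons 0 s : I^(Fin (k+1)))
      (lerp mdp (τ (Fin.cons 0 s : I^(Fin (k+1)))) u),
      valid_mem (valid_lerp α β _ _ _ (hv0 1) hv1 u) s⟩) ?_ ?_ ?_ ?_
    · refine (hcH _ _ _ continuous_const (hcons0.comp continuous_fst) ?_).subtype_mk _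
      exact lerp_cont continuous_const (hτc.comp (hcons0.comp continuous_fst)) continuous_snd
    · intro s; apply Subtype.ext
      change H 1 _ (lerp _ _ 0) = H 1 _ mdp
      rw [lerp_zero]
    · intro s; apply Subtype.ext
      change H 1 _ (lerp _ _ 1) = H 1 _ (τ _)
      rw [lerp_one]
    · intro s hs u; exact Subtype.ext (hHe _ _ _ (F_b 0 s hs _))
  have h3 : GenLoop.Homotopic b2 GenLoop.const := by
    refine hom_of (fun s v => ⟨H 1 (Fin.cons v s : I^(Fin (k+1))) (τ (Fin.cons v s : I^(Fin (k+1)))),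
      valid_mem hτ _⟩) ?_ ?_ ?_ ?_
    · exact (hcH _ _ _ continuous_const continuous_cons (hτc.comp continuous_cons)).subtype_mk _
    · intro s; rfl
    · intro s; exact Subtype.ext (hHe _ _ _ (F_1 s _))
    · intro s hs u; exact Subtype.ext (hHe _ _ _ (F_b _ s hs _))
  exact h1.trans (h2.trans h3)

theorem susp_equiv {k : ℕ} (hk : k + 1 + 1 + 4 < 2 * Module.finrank ℝ E) (hαβ : α ≠ β) :
    Nonempty (HomotopyGroup (Fin (k+1)) (YY (E := E) α β) ⟨e, hα, hβ⟩ ≃*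
      HomotopyGroup (Fin (k+1+1)) Sph e) := by
  refine mulEquiv_of_rel (fun a f => GenLoop.Homotopic (SM hα hβ a) f) 0 (Fin.succ 0)
    (fun a => ⟨_, GenLoop.Homotopic.refl _⟩) ?_ ?_ ?_ ?_
  · intro f
    obtain ⟨H, hHc, hH0, hHe, -, hHg⟩ := general_position (k := k+1) (by omega) α β e hαβ hα.symm
      hβ.symm (unfam f) (unfam_cont f) one_pos
    let f' : Ω^ (Fin (k+1+1)) Sph e := famLoop (H 1)
      (hHc.comp (continuous_const.prodMk continuous_id))
      (fun s => hHe _ _ _ (unfam_zero f s)) (fun s => hHe _ _ _ (unfam_one f s))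
      (fun s hs t => hHe _ _ _ (unfam_bd f s hs t))
    have hff : GenLoop.Homotopic f f' := by
      refine hom_of (fun y u => H u (Fin.tail y) (y 0)) ?_ ?_ ?_ ?_
      · exact hHc.comp (continuous_snd.prodMk ((continuous_tail.comp continuous_fst).prodMk
          (by fun_prop)))
      · intro y; rw [hH0, unfam_tail]
      · intro y; rfl
      · intro y hy u
        apply hHe
        rw [unfam_tail, loop_bd f y hy]
    have hun : ∀ s t, unfam f' s t = H 1 s t := by
      intro s t
      simp [f', unfam, famLoop_apply]
    obtain ⟨ζ, hζ, hv⟩ := exists_valid α β (unfam f') (unfam_cont f')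
      (fun s => by rw [unfam_zero]; exact hβ) (fun s => by rw [unfam_one]; exact hα)
      (fun s t t' h1 h2 => hHg s t t' (by rw [← hun]; exact h1) (by rw [← hun]; exact h2))
    obtain ⟨a, ha⟩ := SM_surj_aux hα hβ f' ζ hζ hv
    exact ⟨a, ha.trans hff.symm⟩
  · intro f g a b h1 h2 h3
    exact (h1.symm.trans (SM_hom hα hβ h3)).trans h2
  · intro f g a b h1 h2
    rw [SM_transAt]
    exact transAt_congr _ h1 h2
  · intro f a h1 h2
    exact SM_ker hα hβ (by omega) hαβ f (h1.trans h2)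

end Susp

end PartD

section PartE

open unitInterval Topology.Homotopy

theorem pi1_circle (z : Circle) : Nonempty (HomotopyGroup (Fin 1) Circle z ≃* Multiplicative ℤ) := by
  have hT : (0 : ℝ) < 2 * Real.pi := by positivity
  haveI : Fact ((0 : ℝ) < 2 * Real.pi) := ⟨hT⟩
  obtain ⟨e, he⟩ : ∃ x : AddCircle (2 * Real.pi), AddCircle.homeomorphCircle' x = z :=
    AddCircle.homeomorphCircle'.surjective z
  obtain ⟨r, hr⟩ : ∃ r : ℝ, (r : AddCircle (2 * Real.pi)) = e := QuotientAddGroup.mk_surjective e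
  obtain ⟨E1⟩ := mulEquiv_of_homeo (N := Fin 1) AddCircle.homeomorphCircle' he
  have E2 := HomotopyGroup.pi1MulEquivFundamentalGroup (X := AddCircle (2 * Real.pi)) (x := e)
  have E3 := (AddCircle.isAddQuotientCoveringMap_coe (2 * Real.pi)).fundamentalGroupEquiv
    (⟨r, hr⟩ : (fun x : ℝ => (x : AddCircle (2 * Real.pi))) ⁻¹' {e})
  let φ : ℤ →+ AddSubgroup.zmultiples (2 * Real.pi) :=
    { toFun := fun n => ⟨n • (2 * Real.pi), n, rfl⟩
      map_zero' := by ext; simp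
      map_add' := fun a b => by ext; simp [add_mul] }
  have hφ : Function.Bijective φ := by
    constructor
    · intro a b h
      have := congrArg Subtype.val h
      simp only [φ, AddMonoidHom.coe_mk, ZeroHom.coe_mk, zsmul_eq_mul] at this
      have := mul_right_cancel₀ hT.ne' this
      exact_mod_cast this
    · rintro ⟨x, n, hn⟩
      exact ⟨n, Subtype.ext hn⟩
  let E4 : Multiplicative ℤ ≃* Multiplicative (AddSubgroup.zmultiples (2 * Real.pi)) :=
    AddEquiv.toMultiplicative (AddEquiv.ofBijective φ hφ)
  let E5 : (Multiplicative (AddSubgroup.zmultiples (2 * Real.pi)))ᵐᵒᵖ ≃*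
    Multiplicative (AddSubgroup.zmultiples (2 * Real.pi)) :=
    { toFun := MulOpposite.unop
      invFun := MulOpposite.op
      left_inv := fun _ => rfl
      right_inv := fun _ => rfl
      map_mul' := fun a b => by rw [MulOpposite.unop_mul]; exact mul_comm _ _ }
  exact ⟨E1.symm.trans (E2.trans (E3.trans (E5.trans E4.symm)))⟩

/-- the exponential covering as a fibration -/
def circleFib : Fib (Multiplicative ℝ) Circle (Multiplicative ℤ) 1 where
  p := fun r => Circle.exp r.toAdd
  pc := Circle.exp.continuous.comp continuous_toAdd
  p1 := by simp
  τ :=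
    { T := fun x y => Multiplicative.ofAdd (Complex.arg ((y * x⁻¹ : Circle) : ℂ))
      D := {q | ((q.2 * q.1⁻¹ : Circle) : ℂ) ∈ Complex.slitPlane}
      openD := Complex.isOpen_slitPlane.preimage (by fun_prop)
      diag := by intro x; simp
      cont := by
        refine continuous_ofAdd.comp_continuousOn ?_
        intro q hq
        refine ContinuousAt.continuousWithinAt ?_
        refine ContinuousAt.comp (f := fun q : Circle × Circle => ((q.2 * q.1⁻¹ : Circle) : ℂ))
          (Complex.continuousAt_arg hq) ?_
        exact Continuous.continuousAt (by fun_prop)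
      spec := by
        intro x y _ g hg
        simp only [toAdd_mul, toAdd_ofAdd, Circle.exp_add, hg, Circle.exp_arg]
        simp
      one := by intro x; simp }
  ι := AddMonoidHom.toMultiplicative
    { toFun := fun n : ℤ => (2 * Real.pi) * (n : ℝ)
      map_zero' := by simp
      map_add' := fun a b => by push_cast; ring }
  emb := by
    have h1 : Topology.IsEmbedding fun n : ℤ => (2 * Real.pi) * (n : ℝ) :=
      (Homeomorph.mulLeft₀ (2 * Real.pi) (by positivity)).isEmbedding.comp
        Int.isClosedEmbedding_coe_real.isEmbedding
    exact h1
  fib := by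
    intro g g'
    rw [eq_comm, Circle.exp_eq_exp]
    constructor
    · rintro ⟨m, hm⟩
      refine ⟨Multiplicative.ofAdd m, ?_⟩
      apply Multiplicative.toAdd.injective
      rw [hm]; simp [mul_comm]
    · rintro ⟨m, hm⟩
      refine ⟨m.toAdd, ?_⟩
      rw [hm]; simp [mul_comm]

theorem circle_null {n : ℕ} (f : Ω^ (Fin (n+1+1)) Circle 1) : GenLoop.Homotopic f GenLoop.const := by
  obtain ⟨a, ha⟩ := circleFib.bd_total f
  refine circleFib.bd_ker ?_ f a ha ?_
  · intro g
    refine ⟨GenLoop.const, ?_⟩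
    refine hom_of (fun y t => Multiplicative.ofAdd ((1 - (t : ℝ)) * (g y).toAdd)) ?_ ?_ ?_ ?_
    · have := loop_cont g
      refine continuous_ofAdd.comp ?_
      have h2 : Continuous fun p : (I^(Fin (n+1+1))) × I => (g p.1).toAdd :=
        continuous_toAdd.comp (this.comp continuous_fst)
      fun_prop
    · intro y; simp
    · intro y; simp [Fib.incl_apply, GenLoop.const]
    · intro y hy t; simp [loop_bd g y hy]
  · have : a = GenLoop.const := by
      ext1 y
      have h := (PreconnectedSpace.isPreconnected_univ (α := I^(Fin (n+1)))).constant
        (loop_cont a).continuousOn (Set.mem_univ y) (Set.mem_univ (fun _ => (0 : I)))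
      rw [h]
      exact loop_bd a _ ⟨0, Or.inl rfl⟩
    rw [this]

end PartE

section PartF

open unitInterval Topology.Homotopy

/-- unit quaternions -/
abbrev S3 : Type := Metric.sphere (0 : ℍ[ℝ]) 1

open Classical in
/-- normalisation of quaternions, with a junk value at zero -/
def nz (w : ℍ[ℝ]) : S3 := if h : w ≠ 0 then nrm w h else 1

theorem nz_val {w : ℍ[ℝ]} (h : w ≠ 0) : ((nz w : S3) : ℍ[ℝ]) = ‖w‖⁻¹ • w := by
  rw [nz, dif_pos h]; rfl

theorem nz_contOn : ContinuousOn nz {w | w ≠ 0} := by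
  rw [continuousOn_iff_continuous_restrict]
  have : Set.domRestrict {w : ℍ[ℝ] | w ≠ 0} nz = fun w => nrm w.1 w.2 := by
    ext1 w
    exact dif_pos w.2
  rw [this]
  exact nrm_cont _ continuous_subtype_val _

theorem S3_mul_star (g : S3) : (g : ℍ[ℝ]) * star (g : ℍ[ℝ]) = 1 := by
  rw [Quaternion.self_mul_star, Quaternion.normSq_eq_norm_mul_self, sph_norm]; simp

theorem S3_star_mul (g : S3) : star (g : ℍ[ℝ]) * (g : ℍ[ℝ]) = 1 := by
  rw [Quaternion.star_mul_self, Quaternion.normSq_eq_norm_mul_self, sph_norm]; simp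

theorem S3_inv (g : S3) : ((g⁻¹ : S3) : ℍ[ℝ]) = star (g : ℍ[ℝ]) := by
  have h := S3_mul_star g
  have h2 : ((g⁻¹ : S3) : ℍ[ℝ]) * g = 1 := by
    have : (g⁻¹ * g : S3) = 1 := inv_mul_cancel g
    exact congrArg Subtype.val this
  calc ((g⁻¹ : S3) : ℍ[ℝ]) = (g⁻¹ : S3) * (g * star (g : ℍ[ℝ])) := by rw [h, mul_one]
    _ = _ := by rw [← mul_assoc, h2, one_mul]

/-- the imaginary unit -/
def qi : ℍ[ℝ] := ⟨0, 1, 0, 0⟩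

theorem qi_re : qi.re = 0 := rfl

theorem qi_imI : qi.imI = 1 := rfl

theorem qi_imJ : qi.imJ = 0 := rfl

theorem qi_imK : qi.imK = 0 := rfl

theorem norm_qi : ‖qi‖ = 1 := by
  rw [← sq_eq_sq₀ (norm_nonneg _) zero_le_one, sq, ← Quaternion.normSq_eq_norm_mul_self,
    Quaternion.normSq_def', qi_re, qi_imI, qi_imJ, qi_imK]; simp

theorem norm_cplx (z : ℂ) : ‖(z : ℍ[ℝ])‖ = ‖z‖ := by
  rw [← sq_eq_sq₀ (norm_nonneg _) (norm_nonneg _), sq, ← Quaternion.normSq_eq_norm_mul_self,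
    Quaternion.normSq_def', ← Complex.normSq_eq_norm_sq, Complex.normSq_apply]
  simp; ring

theorem cplx_cont : Continuous (fun z : ℂ => (z : ℍ[ℝ])) := by
  have : (fun z : ℂ => (z : ℍ[ℝ])) = fun z : ℂ => z.re • (1 : ℍ[ℝ]) + z.im • qi := by
    funext z
    ext <;> simp [qi_re, qi_imI, qi_imJ, qi_imK]
  rw [this]; fun_prop

/-- unit imaginary quaternions -/
abbrev S2 : Type := {x : ℍ[ℝ] // x.re = 0 ∧ ‖x‖ = 1}

theorem S2_sq (x : S2) : (x : ℍ[ℝ]) * x = -1 := by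
  obtain ⟨x, h1, h2⟩ := x
  have h3 : star x = -x := by rw [Quaternion.star_eq_neg]; exact h1
  have h4 : x * star x = 1 := by
    rw [Quaternion.self_mul_star, Quaternion.normSq_eq_norm_mul_self, h2]; simp
  rw [h3] at h4
  have : x * x = - (x * -x) := by simp
  rw [this, h4]

/-- complex numbers of modulus one inside the quaternions -/
def circHom : Circle →* S3 where
  toFun z := ⟨((z : ℂ) : ℍ[ℝ]), by rw [mem_sphere_zero_iff_norm, norm_cplx, Circle.norm_coe]⟩
  map_one' := by apply Subtype.ext; simp
  map_mul' a b := by apply Subtype.ext; simp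

theorem circHom_val (z : Circle) : ((circHom z : S3) : ℍ[ℝ]) = ((z : ℂ) : ℍ[ℝ]) := rfl

theorem circHom_cont : Continuous circHom :=
  (cplx_cont.comp continuous_subtype_val).subtype_mk _

theorem circHom_emb : Topology.IsEmbedding circHom := by
  refine (circHom_cont.isClosedEmbedding ?_).isEmbedding
  intro a b h
  have h1 := congrArg Subtype.val h
  simp only [circHom_val] at h1
  apply Subtype.ext
  apply Complex.ext
  · exact congrArg QuaternionAlgebra.re h1
  · exact congrArg QuaternionAlgebra.imI h1

theorem exists_circ (h : ℍ[ℝ]) (hn : ‖h‖ = 1) (hJ : h.imJ = 0) (hK : h.imK = 0) :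
    ∃ z : Circle, ((z : ℂ) : ℍ[ℝ]) = h := by
  have e : ((⟨h.re, h.imI⟩ : ℂ) : ℍ[ℝ]) = h := by
    ext <;> simp [hJ, hK]
  refine ⟨⟨⟨h.re, h.imI⟩, ?_⟩, e⟩
  change _ ∈ Metric.sphere (0 : ℂ) 1
  rw [mem_sphere_zero_iff_norm, ← norm_cplx, e, hn]

/-- the Hopf fibration -/
def hopf : Fib S3 S2 Circle ⟨qi, qi_re, norm_qi⟩ where
  p := fun g => ⟨g * qi * star (g : ℍ[ℝ]), by
    simp only [Quaternion.re_mul, Quaternion.imI_mul, Quaternion.imJ_mul, Quaternion.imK_mul,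
      qi_re, qi_imI, qi_imJ, qi_imK, Quaternion.re_star, Quaternion.imI_star,
      Quaternion.imJ_star, Quaternion.imK_star]; ring, by
    rw [norm_mul, norm_mul, norm_star, sph_norm, norm_qi]; simp⟩
  pc := by
    refine Continuous.subtype_mk ?_ _
    fun_prop
  p1 := by apply Subtype.ext; simp
  τ :=
    { T := fun x y => nz (1 - (y : ℍ[ℝ]) * x)
      D := {q | 1 - (q.2 : ℍ[ℝ]) * q.1 ≠ 0}
      openD := isOpen_ne.preimage (by fun_prop)
      diag := by
        intro x
        simp only [Set.mem_ofPred_eq, S2_sq]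
        intro h
        have := congrArg QuaternionAlgebra.re h
        simp at this
      cont := by
        refine nz_contOn.comp (Continuous.continuousOn (by fun_prop)) ?_
        intro q hq; exact hq
      spec := by
        intro x y hxy g hg
        have hg' := congrArg Subtype.val hg
        simp only at hg'
        apply Subtype.ext
        have hxy' : 1 - (y : ℍ[ℝ]) * x ≠ 0 := hxy
        set q := nz (1 - (y : ℍ[ℝ]) * x) with hq
        have h1 : (q : ℍ[ℝ]) * x = y * q := by
          rw [hq, nz_val hxy', smul_mul_assoc, mul_smul_comm]
          congr 1
          rw [sub_mul, mul_assoc, S2_sq, mul_sub, ← mul_assoc, S2_sq]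
          noncomm_ring
        change ((q * g : S3) : ℍ[ℝ]) * qi * star ((q * g : S3) : ℍ[ℝ]) = y
        have h2 : ((q * g : S3) : ℍ[ℝ]) = q * g := rfl
        rw [h2, star_mul]
        calc (q : ℍ[ℝ]) * g * qi * (star (g : ℍ[ℝ]) * star (q : ℍ[ℝ]))
            = q * (g * qi * star (g : ℍ[ℝ])) * star (q : ℍ[ℝ]) := by noncomm_ring
          _ = y := by rw [hg', h1, mul_assoc, S3_mul_star, mul_one]
      one := by
        intro x
        apply Subtype.ext
        have h2 : (1 : ℍ[ℝ]) - x * x = (2 : ℝ) • 1 := by rw [S2_sq, sub_neg_eq_add, two_smul]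
        have h3 : (1 : ℍ[ℝ]) - x * x ≠ 0 := by rw [h2]; simp
        rw [nz_val h3, h2, norm_smul, smul_smul]; simp }
  ι := circHom
  emb := circHom_emb
  fib := by
    intro g g'
    constructor
    · intro h
      have h := congrArg Subtype.val h
      simp only at h
      let k : S3 := g⁻¹ * g'
      have hk : (k : ℍ[ℝ]) = star (g : ℍ[ℝ]) * g' := by
        change ((g⁻¹ : S3) : ℍ[ℝ]) * g' = _
        rw [S3_inv]
      have hcomm : (k : ℍ[ℝ]) * qi = qi * k := by
        rw [hk]
        calc star (g : ℍ[ℝ]) * g' * qi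
            = star (g : ℍ[ℝ]) * (g' * qi * star (g' : ℍ[ℝ])) * g' := by
              rw [mul_assoc _ _ (g' : ℍ[ℝ]), mul_assoc _ _ (g' : ℍ[ℝ]), S3_star_mul, mul_one,
                mul_assoc]
          _ = (star (g : ℍ[ℝ]) * g) * qi * (star (g : ℍ[ℝ]) * g') := by
              rw [← h]; noncomm_ring
          _ = _ := by rw [S3_star_mul, one_mul]
      have hJ : (k : ℍ[ℝ]).imJ = 0 := by
        have := congrArg QuaternionAlgebra.imK hcomm
        simp only [Quaternion.re_mul, Quaternion.imI_mul, Quaternion.imJ_mul,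
          Quaternion.imK_mul, qi_re, qi_imI, qi_imJ, qi_imK] at this
        linarith
      have hK : (k : ℍ[ℝ]).imK = 0 := by
        have := congrArg QuaternionAlgebra.imJ hcomm
        simp only [Quaternion.re_mul, Quaternion.imI_mul, Quaternion.imJ_mul,
          Quaternion.imK_mul, qi_re, qi_imI, qi_imJ, qi_imK] at this
        linarith
      obtain ⟨z, hz⟩ := exists_circ k (sph_norm k) hJ hK
      refine ⟨z, ?_⟩
      have : circHom z = k := Subtype.ext hz
      rw [this]; simp [k]
    · rintro ⟨z, rfl⟩
      apply Subtype.ext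
      have h1 : ((g * circHom z : S3) : ℍ[ℝ]) = g * circHom z := rfl
      have h3 := S3_mul_star (circHom z)
      have h2 : (circHom z : ℍ[ℝ]) * qi = qi * circHom z := by
        rw [circHom_val]; ext <;> simp [Quaternion.re_mul, Quaternion.imI_mul, Quaternion.imJ_mul,
          Quaternion.imK_mul, qi_re, qi_imI, qi_imJ, qi_imK]
      simp only [h1, star_mul]
      calc (g : ℍ[ℝ]) * qi * star (g : ℍ[ℝ])
          = g * (qi * (circHom z * star (circHom z : ℍ[ℝ]))) * star (g : ℍ[ℝ]) := by
            rw [h3, mul_one]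
        _ = g * (qi * circHom z) * star (circHom z : ℍ[ℝ]) * star (g : ℍ[ℝ]) := by noncomm_ring
        _ = _ := by rw [← h2]; noncomm_ring

theorem finrank_quat : Module.finrank ℝ ℍ[ℝ] = 4 := by
  exact Quaternion.finrank_eq_four

theorem S3_null {k : ℕ} (hk : k < 3) (e : S3) (f : Ω^ (Fin k) S3 e) :
    GenLoop.Homotopic f GenLoop.const :=
  sphere_null (by rw [finrank_quat]; omega) e f

end PartF

section PartG

open unitInterval Topology.Homotopy

theorem pi2_S2 : Nonempty (HomotopyGroup (Fin 2) S2 ⟨qi, qi_re, norm_qi⟩ ≃* Multiplicative ℤ) := by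
  obtain ⟨e1⟩ := hopf.equiv_of_null (n := 0)
    (fun g => ⟨GenLoop.const, by
      refine (S3_null (k := 2) (by norm_num) 1 g).trans ?_
      have : hopf.incl (GenLoop.const : Ω^ (Fin 2) Circle 1) = GenLoop.const := by
        ext1 s; exact map_one circHom
      rw [this]⟩)
    (fun a => S3_null (k := 1) (by norm_num) 1 _)
  obtain ⟨e2⟩ := pi1_circle 1
  exact ⟨e1.trans e2⟩

theorem im_ne_zero_iff (y : S3) : (y : ℍ[ℝ]).im ≠ 0 ↔ (y ≠ 1 ∧ y ≠ -1) := by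
  constructor
  · intro h
    constructor
    · rintro rfl; exact h (by ext <;> simp)
    · rintro rfl; exact h (by ext <;> simp)
  · rintro ⟨h1, h2⟩ h
    have e : (y : ℍ[ℝ]) = ((y : ℍ[ℝ]).re : ℍ[ℝ]) := by
      have := Quaternion.re_add_im (y : ℍ[ℝ])
      rw [h, add_zero] at this; exact this.symm
    have hn := sph_norm y
    rw [e, Quaternion.norm_coe, Real.norm_eq_abs] at hn
    rcases eq_or_eq_neg_of_abs_eq hn with h3 | h3
    · apply h1; apply Subtype.ext; rw [e, h3]; simp
    · apply h2; apply Subtype.ext; rw [e, h3]; simp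

/-- The twice punctured three-sphere -/
abbrev Y3 : Type := YY (E := ℍ[ℝ]) (1 : S3) (-1 : S3)

theorem Y3_im (y : Y3) : ((y : S3) : ℍ[ℝ]).im ≠ 0 := (im_ne_zero_iff _).2 y.2

/-- retraction to the equator -/
def eqr (y : Y3) : S2 := ⟨‖((y : S3) : ℍ[ℝ]).im‖⁻¹ • ((y : S3) : ℍ[ℝ]).im, by simp, by
  rw [norm_smul, norm_inv, norm_norm, inv_mul_cancel₀ (norm_ne_zero_iff.2 (Y3_im y))]⟩

theorem eqr_cont : Continuous eqr := by
  have h : Continuous fun y : Y3 => ((y : S3) : ℍ[ℝ]).im :=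
    Quaternion.continuous_im.comp (continuous_subtype_val.comp continuous_subtype_val)
  exact Continuous.subtype_mk
    ((h.norm.inv₀ (fun k => norm_ne_zero_iff.2 (Y3_im k))).smul h) _

theorem S2_im (x : S2) : (x : ℍ[ℝ]).im = x := by
  ext <;> simp [x.2.1]

theorem S2_ne (x : S2) : (x : ℍ[ℝ]) ≠ 0 := by
  intro h; have := x.2.2; rw [h] at this; simp at this

/-- inclusion of the equator -/
def eqi (x : S2) : Y3 := ⟨⟨x, by simp [x.2.2]⟩, (im_ne_zero_iff _).1 (by
  rw [S2_im]; exact S2_ne x)⟩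

theorem eqi_cont : Continuous eqi :=
  Continuous.subtype_mk (Continuous.subtype_mk continuous_subtype_val _) _

theorem eqr_eqi (x : S2) : eqr (eqi x) = x := by
  apply Subtype.ext
  simp only [eqr, eqi, S2_im, x.2.2]; simp

/-- the homotopy line -/
def eql (y : Y3) (u : I) : ℍ[ℝ] := (1 - (u : ℝ)) • ((y : S3) : ℍ[ℝ]) + (u : ℝ) • (eqr y : ℍ[ℝ])

theorem eql_im (y : Y3) (u : I) : (eql y u).im ≠ 0 := by
  have : (eql y u).im = ((1 - (u : ℝ)) + u * ‖((y : S3) : ℍ[ℝ]).im‖⁻¹) • ((y : S3) : ℍ[ℝ]).im := by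
    ext <;> simp [eql, eqr] <;> ring
  rw [this]
  have h1 : 0 < ‖((y : S3) : ℍ[ℝ]).im‖⁻¹ := by
    have := norm_pos_iff.2 (Y3_im y); positivity
  refine smul_ne_zero ?_ (Y3_im y)
  apply ne_of_gt
  have hu0 := u.2.1
  have hu1 := u.2.2
  rcases hu1.lt_or_eq with h | h
  · have : 0 ≤ (u : ℝ) * ‖((y : S3) : ℍ[ℝ]).im‖⁻¹ := by positivity
    linarith
  · rw [h]; simpa using h1

theorem eql_ne (y : Y3) (u : I) : eql y u ≠ 0 := by
  intro h; apply eql_im y u; rw [h]; simp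

theorem Y3_pi2 (b : Y3) (hb : b = eqi ⟨qi, qi_re, norm_qi⟩) :
    Nonempty (HomotopyGroup (Fin 2) Y3 b ≃* HomotopyGroup (Fin 2) S2 ⟨qi, qi_re, norm_qi⟩) := by
  have hbr : eqr b = ⟨qi, qi_re, norm_qi⟩ := by rw [hb, eqr_eqi]
  refine mulEquiv_of_map eqr eqr_cont hbr ?_ ?_
  · intro a
    refine ⟨mapLoop eqi eqi_cont hb.symm a, ?_⟩
    have : mapLoop eqr eqr_cont hbr (mapLoop eqi eqi_cont hb.symm a) = a := by
      ext1 s; simp only [mapLoop_apply, eqr_eqi]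
    rw [this]
  · intro f hf
    have h1 := mapLoop_hom eqi eqi_cont hb.symm hf
    have h2 : mapLoop eqi eqi_cont hb.symm (GenLoop.const : Ω^ (Fin 2) S2 _) = GenLoop.const := by
      ext1 s; exact hb.symm
    rw [h2] at h1
    refine GenLoop.Homotopic.trans ?_ h1
    have hc : Continuous fun q : Y3 × I => eql q.1 q.2 := by
      have h3 : Continuous fun y : Y3 => (eqr y : ℍ[ℝ]) := continuous_subtype_val.comp eqr_cont
      have h4 : Continuous fun q : Y3 × I => (eqr q.1 : ℍ[ℝ]) := h3.comp continuous_fst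
      unfold eql
      fun_prop
    have hnot : ∀ q : Y3 × I, nrm (eql q.1 q.2) (eql_ne q.1 q.2) ≠ (1 : S3) ∧
        nrm (eql q.1 q.2) (eql_ne q.1 q.2) ≠ (-1 : S3) := by
      intro q
      rw [← im_ne_zero_iff]
      have : (nrm (eql q.1 q.2) (eql_ne q.1 q.2) : ℍ[ℝ]).im = ‖eql q.1 q.2‖⁻¹ • (eql q.1 q.2).im := by
        simp [nrm]
      rw [this]
      exact smul_ne_zero (inv_ne_zero (norm_ne_zero_iff.2 (eql_ne _ _))) (eql_im _ _)
    let HH : Y3 × I → Y3 := fun q => ⟨nrm (eql q.1 q.2) (eql_ne q.1 q.2), hnot q⟩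
    have hHc : Continuous HH := Continuous.subtype_mk (nrm_cont _ hc _) _
    refine hom_of (fun s u => HH (f s, u)) ?_ ?_ ?_ ?_
    · have := loop_cont f
      exact hHc.comp (by fun_prop)
    · intro s
      apply Subtype.ext
      change nrm _ (eql_ne _ _) = _
      rw [nrm_congr (w' := (((f s : Y3) : S3) : ℍ[ℝ])) (by simp [eql]) (eql_ne _ _) (sph_ne_zero _)]
      exact nrm_self _ _
    · intro s
      apply Subtype.ext
      change nrm _ (eql_ne _ _) = _
      rw [nrm_congr (w' := (((eqi (eqr (f s)) : Y3) : S3) : ℍ[ℝ])) (by simp [eql, eqi]) (eql_ne _ _)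
        (sph_ne_zero _)]
      exact nrm_self _ _
    · intro s hs u
      apply Subtype.ext
      change nrm _ (eql_ne _ _) = _
      rw [nrm_congr (w' := ((b : S3) : ℍ[ℝ])) (by
        rw [loop_bd f s hs, eql, hbr, hb]; simp only [eqi]; rw [← add_smul]; simp) (eql_ne _ _)
        (sph_ne_zero _)]
      exact nrm_self _ _

theorem pi3_S3 : Nonempty (HomotopyGroup (Fin 3) S3 1 ≃* Multiplicative ℤ) := by
  let b : Y3 := eqi ⟨qi, qi_re, norm_qi⟩
  have hne : (1 : S3) ≠ -1 := by
    intro h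
    have h := congrArg (fun x : S3 => (x : ℍ[ℝ]).re) h
    norm_num at h
  obtain ⟨e1⟩ := susp_equiv (E := ℍ[ℝ]) (k := 1) (α := (1 : S3)) (β := (-1 : S3)) (e := b.1)
    b.2.1 b.2.2 (by rw [finrank_quat]; norm_num) hne
  obtain ⟨e2⟩ := Y3_pi2 ⟨b.1, b.2.1, b.2.2⟩ rfl
  obtain ⟨e3⟩ := pi2_S2
  obtain ⟨e4⟩ := mulEquiv_of_homeo (N := Fin 3) (Homeomorph.mulLeft (b.1 : S3)) (x := 1) (y := b.1)
    (by simp)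
  exact ⟨e4.trans (e1.symm.trans (e2.trans e3))⟩

end PartG

section PartH

open unitInterval Topology.Homotopy

theorem star_ring_unit {R : Type} [Ring R] [StarRing R] (W C B : R) (hB : star W * W = B)
    (h1 : star C * B * C = C + star C) :
    star (1 - W * C * star W) * (1 - W * C * star W) = 1 := by
  simp only [star_sub, star_mul, star_star, star_one]
  calc (1 - W * (star C * star W)) * (1 - W * C * star W)
      = 1 - W * C * star W - W * star C * star W + W * (star C * (star W * W) * C) * star W := by
        noncomm_ring
    _ = 1 := by rw [hB, h1]; noncomm_ring

theorem star_ring_unit' {R : Type} [Ring R] [StarRing R] (W C B : R) (hB : star W * W = B)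
    (h1 : C * B * star C = C + star C) :
    (1 - W * C * star W) * star (1 - W * C * star W) = 1 := by
  simp only [star_sub, star_mul, star_star, star_one]
  calc (1 - W * C * star W) * (1 - W * (star C * star W))
      = 1 - W * C * star W - W * star C * star W + W * (C * (star W * W) * star C) * star W := by
        noncomm_ring
    _ = 1 := by rw [hB, h1]; noncomm_ring

/-- three by three quaternionic matrices -/
abbrev M3 : Type := Matrix (Fin 3) (Fin 3) ℍ[ℝ]

/-- matrix with a given first column -/
def colM (x : Fin 3 → ℍ[ℝ]) : M3 := Matrix.of fun i j => if j = 0 then x i else 0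

/-- quaternionic inner product -/
def ip (x y : Fin 3 → ℍ[ℝ]) : ℍ[ℝ] := ∑ i, star (x i) * y i

/-- corner matrix -/
def cor (c : ℍ[ℝ]) : M3 := Matrix.single 0 0 c

theorem star_colM_mul (x y : Fin 3 → ℍ[ℝ]) : star (colM x) * colM y = cor (ip x y) := by
  ext1 i j
  fin_cases i <;> fin_cases j <;>
    simp [Matrix.mul_apply, Fin.sum_univ_three, colM, cor, ip, Matrix.star_eq_conjTranspose,
      Matrix.single]

theorem colM_mul_cor (x : Fin 3 → ℍ[ℝ]) (c : ℍ[ℝ]) : colM x * cor c = colM (fun i => x i * c) := by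
  ext1 i j
  fin_cases i <;> fin_cases j <;>
    simp [Matrix.mul_apply, Fin.sum_univ_three, colM, cor, Matrix.single]

theorem star_cor (c : ℍ[ℝ]) : star (cor c) = cor (star c) := by
  ext1 i j
  fin_cases i <;> fin_cases j <;>
    simp [cor, Matrix.star_eq_conjTranspose, Matrix.single]

theorem cor_mul (c d : ℍ[ℝ]) : cor c * cor d = cor (c * d) := by
  simp [cor]

theorem cor_add (c d : ℍ[ℝ]) : cor c + cor d = cor (c + d) := by
  simp [cor, Matrix.single_add]

theorem colM_add (x y : Fin 3 → ℍ[ℝ]) : colM (x + y) = colM x + colM y := by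
  ext1 i j
  fin_cases j <;> simp [colM]

theorem ip_add_left (x y z : Fin 3 → ℍ[ℝ]) : ip (x + y) z = ip x z + ip y z := by
  simp [ip, add_mul, Finset.sum_add_distrib]

theorem ip_add_right (x y z : Fin 3 → ℍ[ℝ]) : ip x (y + z) = ip x y + ip x z := by
  simp [ip, mul_add, Finset.sum_add_distrib]

theorem star_ip (x y : Fin 3 → ℍ[ℝ]) : star (ip x y) = ip y x := by
  simp [ip, Fin.sum_univ_three]

theorem inv_id1 (a : ℍ[ℝ]) : star a⁻¹ * (a + star a) * a⁻¹ = a⁻¹ + star a⁻¹ := by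
  by_cases h : a = 0
  · subst h; simp
  have h1 : a * a⁻¹ = 1 := mul_inv_cancel₀ h
  have h2 : star a⁻¹ * star a = 1 := by rw [← star_mul, h1, star_one]
  rw [mul_add, h2, add_mul, mul_assoc, h1]; simp [add_comm]

theorem inv_id2 (a : ℍ[ℝ]) : a⁻¹ * (a + star a) * star a⁻¹ = a⁻¹ + star a⁻¹ := by
  by_cases h : a = 0
  · subst h; simp
  have h1 : a⁻¹ * a = 1 := inv_mul_cancel₀ h
  have h2 : star a * star a⁻¹ = 1 := by rw [← star_mul, h1, star_one]
  rw [mul_add, h1, add_mul, mul_assoc _ (star a), h2]; simp [add_comm]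

/-- quaternionic pseudo-reflection part -/
def refl1 (x y : Fin 3 → ℍ[ℝ]) : M3 :=
  1 - colM (x + y) * cor (ip (x + y) x)⁻¹ * star (colM (x + y))

theorem refl1_unitary (x y : Fin 3 → ℍ[ℝ]) (hx : ip x x = 1) (hy : ip y y = 1) :
    refl1 x y ∈ unitary M3 := by
  have hB : star (colM (x + y)) * colM (x + y) =
      cor (ip (x + y) x + star (ip (x + y) x)) := by
    rw [star_colM_mul]
    congr 1
    rw [star_ip, ip_add_right, ip_add_left, ip_add_left, ip_add_right, hx, hy]
    abel
  constructor
  · refine star_ring_unit _ _ _ hB ?_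
    rw [star_cor, cor_mul, cor_mul, inv_id1, cor_add]
  · refine star_ring_unit' _ _ _ hB ?_
    rw [star_cor, cor_mul, cor_mul, inv_id2, cor_add]

theorem refl1_mul (x y : Fin 3 → ℍ[ℝ]) (h : ip (x + y) x ≠ 0) :
    refl1 x y * colM x = - colM y := by
  rw [refl1, sub_mul, mul_assoc, star_colM_mul, mul_assoc, cor_mul, inv_mul_cancel₀ h,
    colM_mul_cor]
  simp only [mul_one, one_mul]
  change colM x - colM (x + y) = _
  rw [colM_add]
  abel

theorem qtwo : (1 + 1 : ℍ[ℝ]) ≠ 0 := by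
  intro h
  have h := congrArg QuaternionAlgebra.re h
  rw [Quaternion.re_add] at h
  simp only [Quaternion.re_one, Quaternion.re_zero] at h
  norm_num at h

theorem refl1_self (x : Fin 3 → ℍ[ℝ]) (hx : ip x x = 1) :
    refl1 x x = 1 - (colM x * star (colM x) + colM x * star (colM x)) := by
  rw [refl1, ip_add_left, hx, colM_mul_cor]
  have : (fun i => (x + x) i * ((1 + 1 : ℍ[ℝ]))⁻¹) = x := by
    funext i
    have h2 := qtwo
    rw [Pi.add_apply, ← mul_two, mul_assoc, ← one_add_one_eq_two, mul_inv_cancel₀ h2, mul_one]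
  rw [this, colM_add, star_add, mul_add]

/-- the transporter matrix -/
def trM (x y : Fin 3 → ℍ[ℝ]) : M3 := refl1 x y * refl1 x x

theorem trM_unitary (x y : Fin 3 → ℍ[ℝ]) (hx : ip x x = 1) (hy : ip y y = 1) :
    trM x y ∈ unitary M3 := mul_mem (refl1_unitary x y hx hy) (refl1_unitary x x hx hx)

theorem ip_self_ne (x : Fin 3 → ℍ[ℝ]) (hx : ip x x = 1) : ip (x + x) x ≠ 0 := by
  rw [ip_add_left, hx]
  exact qtwo

theorem trM_mul (x y : Fin 3 → ℍ[ℝ]) (hx : ip x x = 1) (h : ip (x + y) x ≠ 0) :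
    trM x y * colM x = colM y := by
  rw [trM, mul_assoc, refl1_mul x x (ip_self_ne x hx), mul_neg, refl1_mul x y h, neg_neg]

theorem trM_self (x : Fin 3 → ℍ[ℝ]) (hx : ip x x = 1) : trM x x = 1 := by
  have h1 := (refl1_unitary x x hx hx).1
  have h2 : star (refl1 x x) = refl1 x x := by
    rw [refl1_self x hx]
    simp [star_sub, star_mul]
  rw [h2] at h1
  exact h1

/-- projection matrix -/
def prj (i : Fin 3) : M3 := Matrix.single i i 1

theorem star_colM_prj (x : Fin 3 → ℍ[ℝ]) (i : Fin 3) (h : x i = 0) :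
    star (colM x) * prj i = 0 := by
  ext1 a b
  fin_cases i <;> fin_cases a <;> fin_cases b <;> simp at h <;>
    simp [Matrix.mul_apply, Fin.sum_univ_three, colM, prj, Matrix.star_eq_conjTranspose,
      Matrix.single, h]

theorem refl1_prj (x y : Fin 3 → ℍ[ℝ]) (i : Fin 3) (hx : x i = 0) (hy : y i = 0) :
    refl1 x y * prj i = prj i := by
  rw [refl1, sub_mul, mul_assoc, star_colM_prj _ _ (by simp [hx, hy])]
  simp

theorem trM_prj (x y : Fin 3 → ℍ[ℝ]) (i : Fin 3) (hx : x i = 0) (hy : y i = 0) :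
    trM x y * prj i = prj i := by
  rw [trM, mul_assoc, refl1_prj x x i hx hx, refl1_prj x y i hx hy]

theorem colM_cont : Continuous colM := by
  refine continuous_matrix fun i j => ?_
  simp only [colM, Matrix.of_apply]
  split_ifs <;> fun_prop

theorem cor_cont : Continuous cor := by
  refine continuous_matrix fun i j => ?_
  simp only [cor, Matrix.single, Matrix.of_apply]
  split_ifs <;> fun_prop

theorem ip_cont : Continuous fun q : (Fin 3 → ℍ[ℝ]) × (Fin 3 → ℍ[ℝ]) => ip q.1 q.2 := by
  unfold ip; fun_prop

theorem refl1_cont : ContinuousOn (fun q : (Fin 3 → ℍ[ℝ]) × (Fin 3 → ℍ[ℝ]) => refl1 q.1 q.2)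
    {q | ip (q.1 + q.2) q.1 ≠ 0} := by
  unfold refl1
  have h1 : Continuous fun q : (Fin 3 → ℍ[ℝ]) × (Fin 3 → ℍ[ℝ]) => colM (q.1 + q.2) :=
    colM_cont.comp (by fun_prop)
  have h2 : Continuous fun q : (Fin 3 → ℍ[ℝ]) × (Fin 3 → ℍ[ℝ]) => ip (q.1 + q.2) q.1 :=
    ip_cont.comp (f := fun q : (Fin 3 → ℍ[ℝ]) × (Fin 3 → ℍ[ℝ]) => (q.1 + q.2, q.1)) (by fun_prop)
  have h3 : ContinuousOn (fun q : (Fin 3 → ℍ[ℝ]) × (Fin 3 → ℍ[ℝ]) =>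
      cor (ip (q.1 + q.2) q.1)⁻¹) {q | ip (q.1 + q.2) q.1 ≠ 0} :=
    cor_cont.comp_continuousOn (h2.continuousOn.inv₀ (fun q hq => hq))
  exact continuousOn_const.sub ((h1.continuousOn.mul h3).mul h1.star.continuousOn)

theorem trM_cont {K : Type} [TopologicalSpace K] (x y : K → Fin 3 → ℍ[ℝ]) (hx : Continuous x)
    (hy : Continuous y) (h1 : ∀ k, ip (x k) (x k) = 1) :
    ContinuousOn (fun k => trM (x k) (y k)) {k | ip (x k + y k) (x k) ≠ 0} := by
  refine ContinuousOn.mul ?_ ?_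
  · exact refl1_cont.comp (f := fun k => (x k, y k)) (hx.prodMk hy).continuousOn (fun k hk => hk)
  · exact refl1_cont.comp (f := fun k => (x k, x k)) (hx.prodMk hx).continuousOn
      (fun k hk => ip_self_ne _ (h1 k))

end PartH

section PartI

open unitInterval Topology.Homotopy

/-- the quaternionic three-space -/
abbrev V3 : Type := PiLp 2 (fun _ : Fin 3 => ℍ[ℝ])

/-- coordinate subspace -/
def WS (S : Set (Fin 3)) : Submodule ℝ V3 where
  carrier := {x | ∀ i ∈ S, x i = 0}
  add_mem' := by
    intro a b ha hb i hi
    simp [ha i hi, hb i hi]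
  zero_mem' := by intro i _; rfl
  smul_mem' := by
    intro c a ha i hi
    simp [ha i hi]

theorem finrank_WS (S : Set (Fin 3)) (hS : S ⊆ {2}) : 8 ≤ Module.finrank ℝ (WS S) := by
  have h8 : Module.finrank ℝ (ℍ[ℝ] × ℍ[ℝ]) = 8 := by
    rw [Module.finrank_prod, finrank_quat]
  let φ : (ℍ[ℝ] × ℍ[ℝ]) →ₗ[ℝ] WS S :=
    { toFun := fun q => ⟨WithLp.toLp 2 ![q.1, q.2, 0], by
        intro i hi
        have : i = 2 := hS hi
        subst this
        rfl⟩
      map_add' := by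
        intro a b
        apply Subtype.ext
        ext1 i
        fin_cases i <;> simp
      map_smul' := by
        intro c a
        apply Subtype.ext
        ext1 i
        fin_cases i <;> simp }
  rw [← h8]
  refine LinearMap.finrank_le_finrank_of_injective (f := φ) ?_
  intro a b h
  have h0 := congrArg (fun x : WS S => x.1 0) h
  have h1 := congrArg (fun x : WS S => x.1 1) h
  exact Prod.ext h0 h1

/-- unit sphere in a coordinate subspace -/
abbrev XS (S : Set (Fin 3)) : Type := Metric.sphere (0 : WS S) 1

/-- coordinates -/
def co {S : Set (Fin 3)} (x : XS S) : Fin 3 → ℍ[ℝ] := fun i => x.1.1 i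

theorem co_cont {S : Set (Fin 3)} : Continuous (co : XS S → _) := by
  refine continuous_pi fun i => ?_
  have : Continuous fun x : XS S => x.1.1 := by fun_prop
  unfold co
  fun_prop

theorem ip_norm (x : V3) : ip (fun i => x i) (fun i => x i) = ((‖x‖ ^ 2 : ℝ) : ℍ[ℝ]) := by
  rw [PiLp.norm_sq_eq_of_L2, ip, Fin.sum_univ_three, Fin.sum_univ_three]
  simp only [Quaternion.star_mul_self, Quaternion.normSq_eq_norm_mul_self, sq]
  push_cast
  rfl

theorem co_ip {S : Set (Fin 3)} (x : XS S) : ip (co x) (co x) = 1 := by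
  have h := ip_norm x.1.1
  have h2 : ‖x.1.1‖ = 1 := sph_norm x
  rw [h2] at h
  rw [one_pow, Quaternion.coe_one] at h
  exact h

theorem co_inj {S : Set (Fin 3)} {x y : XS S} (h : co x = co y) : x = y := by
  apply Subtype.ext; apply Subtype.ext
  ext1 i
  exact congrFun h i

/-- make a point of the sphere -/
def mkXS {S : Set (Fin 3)} (x : Fin 3 → ℍ[ℝ]) (h : ip x x = 1) (h0 : ∀ i ∈ S, x i = 0) : XS S :=
  ⟨⟨WithLp.toLp 2 x, h0⟩, by
    rw [mem_sphere_zero_iff_norm]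
    have h1 := ip_norm (WithLp.toLp 2 x)
    have h2 : ip (fun i => (WithLp.toLp 2 x : V3) i) (fun i => (WithLp.toLp 2 x : V3) i) = 1 := h
    rw [h2] at h1
    have h3 : (‖(WithLp.toLp 2 x : V3)‖ ^ 2 : ℝ) = 1 := by
      have := congrArg QuaternionAlgebra.re h1
      rw [Quaternion.re_coe, Quaternion.re_one] at this
      exact this.symm
    change ‖(WithLp.toLp 2 x : V3)‖ = 1
    exact (pow_eq_one_iff_of_nonneg (norm_nonneg _) two_ne_zero).1 h3⟩

theorem co_mkXS {S : Set (Fin 3)} (x : Fin 3 → ℍ[ℝ]) (h : ip x x = 1) (h0 : ∀ i ∈ S, x i = 0) :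
    co (mkXS x h h0) = x := rfl

/-- pointwise stabiliser of basis vectors -/
def GS (S : Set (Fin 3)) : Subgroup Sp3 where
  carrier := {g | ∀ i ∈ S, g.1 * prj i = prj i}
  mul_mem' := by
    intro a b ha hb i hi
    change a.1 * b.1 * prj i = prj i
    rw [mul_assoc, hb i hi, ha i hi]
  one_mem' := by intro i hi; exact one_mul _
  inv_mem' := by
    intro a ha i hi
    change star a.1 * prj i = prj i
    conv_lhs => rw [← ha i hi]
    rw [← mul_assoc, a.2.1, one_mul]

theorem star_prj (i : Fin 3) : star (prj i) = prj i := by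
  simp [prj, Matrix.star_eq_conjTranspose]

theorem prj_mul (g : Sp3) (i : Fin 3) (h : g.1 * prj i = prj i) : prj i * g.1 = prj i := by
  have h1 : star g.1 * prj i = prj i := by
    conv_lhs => rw [← h]
    rw [← mul_assoc, g.2.1, one_mul]
  have h2 := congrArg star h1
  rwa [star_mul, star_star, star_prj] at h2

theorem mul_prj_apply (A : M3) (i a : Fin 3) : (A * prj i) a i = A a i := by
  simp [prj, Matrix.mul_apply, Fin.sum_univ_three, Matrix.single]

theorem prj_mul_apply (A : M3) (i a : Fin 3) : (prj i * A) i a = A i a := by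
  simp [prj, Matrix.mul_apply, Fin.sum_univ_three, Matrix.single]

theorem fix_row (g : Sp3) (i j : Fin 3) (hij : i ≠ j) (h : g.1 * prj i = prj i) : g.1 i j = 0 := by
  have := prj_mul_apply g.1 i j
  rw [prj_mul g i h] at this
  rw [← this]; simp [prj, Matrix.single, hij]

theorem fix_col (g : Sp3) (i j : Fin 3) (hij : i ≠ j) (h : g.1 * prj i = prj i) : g.1 j i = 0 := by
  have := mul_prj_apply g.1 i j
  rw [h] at this
  rw [← this]; simp [prj, Matrix.single, hij]

theorem fix_diag (g : Sp3) (i : Fin 3) (h : g.1 * prj i = prj i) : g.1 i i = 1 := by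
  have := mul_prj_apply g.1 i i
  rw [h] at this
  rw [← this]; simp [prj, Matrix.single]

theorem col_ip (g : Sp3) (j : Fin 3) : ip (fun i => g.1 i j) (fun i => g.1 i j) = 1 := by
  have h := congrFun (congrFun g.2.1 j) j
  rw [Matrix.mul_apply] at h
  simpa [ip, Matrix.star_eq_conjTranspose] using h

/-- column map -/
def pS (S : Set (Fin 3)) (j : Fin 3) (hj : j ∉ S) (g : GS S) : XS S :=
  mkXS (fun i => g.1.1 i j) (col_ip g.1 j)
    (fun i hi => fix_row g.1 i j (fun h => hj (h ▸ hi)) (g.2 i hi))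

theorem pS_cont (S : Set (Fin 3)) (j : Fin 3) (hj : j ∉ S) : Continuous (pS S j hj) := by
  refine Continuous.subtype_mk (Continuous.subtype_mk ?_ _) _
  refine (PiLp.continuous_toLp 2 _).comp ?_
  refine continuous_pi fun i => ?_
  have : Continuous fun g : GS S => g.1.1 := by fun_prop
  exact this.matrix_elem i j

theorem XS_zero {S : Set (Fin 3)} (x : XS S) (i : Fin 3) (hi : i ∈ S) : co x i = 0 := x.1.2 i hi

/-- the transporter for the column map -/
def tS (S : Set (Fin 3)) (j : Fin 3) (hj : j ∉ S) : Transp (pS S j hj) where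
  T x y := ⟨⟨trM (co x) (co y), trM_unitary _ _ (co_ip x) (co_ip y)⟩,
    fun i hi => trM_prj _ _ i (XS_zero x i hi) (XS_zero y i hi)⟩
  D := {q | ip (co q.1 + co q.2) (co q.1) ≠ 0}
  openD := by
    refine isOpen_ne.preimage (ip_cont.comp (f := fun q : XS S × XS S =>
      (co q.1 + co q.2, co q.1)) ?_)
    have h1 : Continuous fun q : XS S × XS S => co q.1 := co_cont.comp continuous_fst
    have h2 : Continuous fun q : XS S × XS S => co q.2 := co_cont.comp continuous_snd
    fun_prop
  diag x := ip_self_ne _ (co_ip x)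
  cont := by
    have h1 : Continuous fun q : XS S × XS S => co q.1 := co_cont.comp continuous_fst
    have h2 : Continuous fun q : XS S × XS S => co q.2 := co_cont.comp continuous_snd
    have := trM_cont _ _ h1 h2 (fun q => co_ip q.1)
    rw [continuousOn_iff_continuous_restrict] at this ⊢
    exact Continuous.subtype_mk (Continuous.subtype_mk this _) _
  spec := by
    intro x y hxy g hg
    apply co_inj
    have h1 := trM_mul (co x) (co y) (co_ip x) hxy
    funext i
    have h2 := congrFun (congrFun h1 i) 0
    rw [Matrix.mul_apply] at h2
    simp only [colM, Matrix.of_apply, if_true] at h2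
    rw [← h2]
    change (trM (co x) (co y) * g.1.1) i j = _
    rw [Matrix.mul_apply]
    refine Finset.sum_congr rfl fun a _ => ?_
    rw [← hg]; rfl
  one x := by
    apply Subtype.ext; apply Subtype.ext
    exact trM_self _ (co_ip x)

theorem pS_fix (S : Set (Fin 3)) (j : Fin 3) (hj : j ∉ S) (g : GS S) :
    pS S j hj g = pS S j hj 1 ↔ g.1.1 * prj j = prj j := by
  constructor
  · intro h
    have h := congrArg co h
    have h1 : ∀ i, g.1.1 i j = (1 : M3) i j := fun i => congrFun h i
    ext1 a b
    simp only [prj, Matrix.mul_apply, Matrix.single, Matrix.of_apply]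
    by_cases hb : j = b
    · subst hb
      simp [h1, Matrix.one_apply]
      by_cases ha : j = a
      · simp [ha]
      · simp [ha, Ne.symm ha]
    · simp [hb]
  · intro h
    apply co_inj
    funext i
    change g.1.1 i j = (1 : M3) i j
    by_cases hi : j = i
    · subst hi; rw [fix_diag g.1 _ h]; simp
    · rw [fix_col g.1 j i hi h, Matrix.one_apply_ne (Ne.symm hi)]

/-- one compression step -/
theorem stage {k : ℕ} (hk : k ≤ 4) (S : Set (Fin 3)) (hS : S ⊆ {2}) (j : Fin 3) (hj : j ∉ S)
    (f : C(I^ (Fin k), Sp3)) (hf : ∀ s, f s ∈ GS S)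
    (hb : ∀ s ∈ Cube.boundary (Fin k), (f s).1 * prj j = prj j) :
    ∃ f' : C(I^ (Fin k), Sp3), f.HomotopicRel f' (Cube.boundary (Fin k)) ∧ (∀ s, f' s ∈ GS S) ∧
      ∀ s, (f' s).1 * prj j = prj j := by
  let f1 : (I^ (Fin k)) → GS S := fun s => ⟨f s, hf s⟩
  have hf1 : Continuous f1 := Continuous.subtype_mk (map_continuous f) _
  let a : Ω^ (Fin k) (XS S) (pS S j hj 1) := mkLoop (fun s => pS S j hj (f1 s))
    ((pS_cont S j hj).comp hf1) (fun s hs => (pS_fix S j hj (f1 s)).2 (hb s hs))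
  have hnull := sphere_null (E := WS S) (by have := finrank_WS S hS; omega) _ a
  obtain ⟨H, hc, h0, h1, hbd⟩ := of_hom hnull
  obtain ⟨L, hLc, hLp, hL0, hLs⟩ := (tS S j hj).lift H hc f1 hf1 (fun s => (h0 s).symm)
  have hLc' : Continuous fun q : (I^ (Fin k)) × I => (L q.1 q.2).1 :=
    continuous_subtype_val.comp hLc
  refine ⟨⟨fun s => (L s 1).1, ?_⟩, ⟨{
    toFun := fun q => (L q.2 q.1).1
    continuous_toFun := ?_
    map_zero_left := ?_
    map_one_left := ?_
    prop' := ?_ }⟩, ?_, ?_⟩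
  · exact hLc'.comp (by fun_prop : Continuous fun s : (I^ (Fin k)) => (s, (1 : I)))
  · exact hLc'.comp (by fun_prop : Continuous fun q : I × (I^ (Fin k)) => (q.2, q.1))
  · intro s; change (L s 0).1 = f s; rw [hL0 s]
  · intro s; rfl
  · intro t s hs
    change (L s t).1 = f s
    rw [hLs s (fun t => by rw [hbd s hs t, hbd s hs 0]) t]
  · intro s; exact (L s 1).2
  · intro s
    refine (pS_fix S j hj (L s 1)).1 ?_
    rw [hLp, h1]; rfl

end PartI

section PartJ

open unitInterval Topology.Homotopy

/-- the isotropy group -/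
abbrev HH : Type := S3 × Circle × S3

/-- diagonal matrices -/
def dgM (h : HH) : M3 := Matrix.diagonal ![(h.1 : ℍ[ℝ]), ((circHom h.2.1 : S3) : ℍ[ℝ]), h.2.2]

theorem star_dgM (h : HH) : star (dgM h) =
    Matrix.diagonal ![star (h.1 : ℍ[ℝ]), star ((circHom h.2.1 : S3) : ℍ[ℝ]),
      star (h.2.2 : ℍ[ℝ])] := by
  rw [Matrix.star_eq_conjTranspose, dgM, Matrix.diagonal_conjTranspose]
  congr 1
  funext i
  fin_cases i <;> rfl

theorem dgM_unitary (h : HH) : dgM h ∈ unitary M3 := by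
  constructor
  · rw [star_dgM, dgM, Matrix.diagonal_mul_diagonal, ← Matrix.diagonal_one]
    congr 1
    funext i
    fin_cases i <;> simp only [Fin.isValue, Fin.zero_eta, Fin.mk_one, Fin.reduceFinMk]
    · exact S3_star_mul _
    · exact S3_star_mul _
    · exact S3_star_mul _
  · rw [star_dgM, dgM, Matrix.diagonal_mul_diagonal, ← Matrix.diagonal_one]
    congr 1
    funext i
    fin_cases i <;> simp only [Fin.isValue, Fin.zero_eta, Fin.mk_one, Fin.reduceFinMk]
    · exact S3_mul_star _
    · exact S3_mul_star _
    · exact S3_mul_star _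

/-- the embedding of the isotropy group -/
def dg : HH →* Sp3 where
  toFun h := ⟨dgM h, dgM_unitary h⟩
  map_one' := by
    apply Subtype.ext
    change dgM 1 = 1
    rw [dgM, ← Matrix.diagonal_one]
    congr 1
    funext i
    fin_cases i <;> simp
  map_mul' a b := by
    apply Subtype.ext
    change dgM (a * b) = dgM a * dgM b
    rw [dgM, dgM, dgM, Matrix.diagonal_mul_diagonal]
    congr 1
    funext i
    fin_cases i <;> simp

theorem dg_val (h : HH) : (dg h).1 = dgM h := rfl

theorem dg_cont : Continuous dg := by
  refine Continuous.subtype_mk ?_ _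
  refine Continuous.matrix_diagonal ?_
  refine continuous_pi fun i => ?_
  have h1 : Continuous fun h : HH => ((circHom h.2.1 : S3) : ℍ[ℝ]) :=
    continuous_subtype_val.comp (circHom_cont.comp (by fun_prop))
  fin_cases i
  · change Continuous fun h : HH => (h.1 : ℍ[ℝ]); fun_prop
  · exact h1
  · change Continuous fun h : HH => (h.2.2 : ℍ[ℝ]); fun_prop

theorem dg_00 (h : HH) : (dg h).1 0 0 = h.1 := rfl

theorem dg_11 (h : HH) : (dg h).1 1 1 = circHom h.2.1 := rfl

theorem dg_22 (h : HH) : (dg h).1 2 2 = h.2.2 := rfl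

theorem dg_inj : Function.Injective dg := by
  intro a b h
  have h0 : (a.1 : ℍ[ℝ]) = b.1 := by rw [← dg_00, ← dg_00, h]
  have h1 : (circHom a.2.1 : ℍ[ℝ]) = circHom b.2.1 := by rw [← dg_11, ← dg_11, h]
  have h2 : (a.2.2 : ℍ[ℝ]) = b.2.2 := by rw [← dg_22, ← dg_22, h]
  exact Prod.ext (Subtype.ext h0)
    (Prod.ext (circHom_emb.injective (Subtype.ext h1)) (Subtype.ext h2))

theorem dg_emb : Topology.IsEmbedding dg := (dg_cont.isClosedEmbedding dg_inj).isEmbedding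

theorem rel_iff (g g' : Sp3) : H'Rel g g' ↔ ∃ h, g' = g * dg h := by
  constructor
  · rintro ⟨h, ⟨q1, q2, z, h1, h2, h3, hJ, hK, hh⟩, rfl⟩
    obtain ⟨w, hw⟩ := exists_circ z h3 hJ hK
    refine ⟨(⟨q1, by simpa using h1⟩, w, ⟨q2, by simpa using h2⟩), ?_⟩
    congr 1
    apply Subtype.ext
    rw [hh, dg_val, dgM]
    simp only [circHom_val, hw]
  · rintro ⟨h, rfl⟩
    exact ⟨dg h, ⟨h.1, h.2.2, circHom h.2.1, sph_norm _, sph_norm _, sph_norm _, rfl, rfl, rfl⟩,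
      rfl⟩

theorem rel_equiv : Equivalence H'Rel where
  refl g := (rel_iff _ _).2 ⟨1, by simp⟩
  symm := by
    intro g g' hg
    obtain ⟨h, rfl⟩ := (rel_iff _ _).1 hg
    exact (rel_iff _ _).2 ⟨h⁻¹, by simp⟩
  trans := by
    intro a b c h1 h2
    obtain ⟨h, rfl⟩ := (rel_iff _ _).1 h1
    obtain ⟨k, rfl⟩ := (rel_iff _ _).1 h2
    exact (rel_iff _ _).2 ⟨h * k, by simp [mul_assoc]⟩

theorem mk_eq_iff (g g' : Sp3) : (Quot.mk H'Rel g = Quot.mk H'Rel g') ↔ ∃ h, g' = g * dg h := by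
  rw [← rel_iff]
  exact rel_equiv.quot_mk_eq_iff g g'

theorem mk_cont : Continuous (Quot.mk H'Rel) := continuous_quot_mk

theorem mk_open : IsOpenQuotientMap (Quot.mk H'Rel) where
  surjective := Quot.mk_surjective
  continuous := mk_cont
  isOpenMap := by
    intro U hU
    rw [isOpen_coinduced]
    have : Quot.mk H'Rel ⁻¹' (Quot.mk H'Rel '' U) = ⋃ h : HH, (fun g => g * dg h) ⁻¹' U := by
      ext g
      simp only [Set.mem_preimage, Set.mem_image, Set.mem_iUnion]
      constructor
      · rintro ⟨u, hu, e⟩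
        obtain ⟨h, rfl⟩ := (mk_eq_iff _ _).1 e
        exact ⟨h⁻¹, by simpa using hu⟩
      · rintro ⟨h, hu⟩
        exact ⟨_, hu, ((mk_eq_iff _ _).2 ⟨h, rfl⟩).symm⟩
    rw [this]
    exact isOpen_iUnion fun h => hU.preimage (continuous_mul_const (dg h))

/-- complex part -/
def cc (w : ℍ[ℝ]) : ℂ := ⟨w.re, w.imI⟩

theorem cc_cont : Continuous cc := by
  have : cc = fun w => (w.re : ℂ) + w.imI * Complex.I := by
    funext w; apply Complex.ext <;> simp [cc]
  rw [this]
  have := Quaternion.continuous_re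
  have := Quaternion.continuous_imI
  fun_prop

theorem cc_mul (a b : ℂ) (w : ℍ[ℝ]) : cc ((a : ℍ[ℝ]) * w * (b : ℍ[ℝ])) = a * cc w * b := by
  apply Complex.ext <;> simp [cc] <;> ring

/-- circle constructor -/
def mkC (x : Metric.sphere (0 : ℂ) 1) : Circle := ⟨x.1, x.2⟩

theorem mkC_val (x : Metric.sphere (0 : ℂ) 1) : ((mkC x : Circle) : ℂ) = x.1 := rfl

theorem mkC_cont : Continuous mkC := Continuous.subtype_mk continuous_subtype_val _

open Classical in
/-- normalised complex part -/
def nzc (w : ℍ[ℝ]) : Circle :=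
  if h : cc w ≠ 0 then mkC (nrm (cc w) h) else 1

theorem nzc_val {w : ℍ[ℝ]} (h : cc w ≠ 0) : ((nzc w : Circle) : ℂ) = ‖cc w‖⁻¹ • cc w := by
  rw [nzc, dif_pos h]; rfl

theorem nzc_contOn : ContinuousOn nzc {w | cc w ≠ 0} := by
  rw [continuousOn_iff_continuous_restrict]
  have : Set.domRestrict {w : ℍ[ℝ] | cc w ≠ 0} nzc =
      fun w => mkC (nrm (cc w.1) w.2) := by
    ext1 w
    exact dif_pos w.2
  rw [this]
  exact mkC_cont.comp (nrm_cont _ (cc_cont.comp continuous_subtype_val) _)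

/-- approximate projection to the isotropy group -/
def hh (g : Sp3) : HH := (nz (g.1 0 0), nzc (g.1 1 1), nz (g.1 2 2))

/-- its domain -/
def VV : Set Sp3 := {g | g.1 0 0 ≠ 0 ∧ cc (g.1 1 1) ≠ 0 ∧ g.1 2 2 ≠ 0}

theorem ent_cont (i j : Fin 3) : Continuous fun g : Sp3 => g.1 i j :=
  continuous_subtype_val.matrix_elem i j

theorem VV_open : IsOpen VV :=
  (isOpen_ne.preimage (ent_cont 0 0)).inter
    ((isOpen_ne.preimage (cc_cont.comp (ent_cont 1 1))).inter (isOpen_ne.preimage (ent_cont 2 2)))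

theorem hh_cont : ContinuousOn hh VV := by
  refine ContinuousOn.prodMk ?_ (ContinuousOn.prodMk ?_ ?_)
  · exact nz_contOn.comp (ent_cont 0 0).continuousOn (fun g hg => hg.1)
  · exact nzc_contOn.comp (ent_cont 1 1).continuousOn (fun g hg => hg.2.1)
  · exact nz_contOn.comp (ent_cont 2 2).continuousOn (fun g hg => hg.2.2)

theorem tri_00 (a b : HH) (g : Sp3) : (dg a * g * dg b).1 0 0 = a.1 * g.1 0 0 * b.1 := by
  change (dgM a * g.1 * dgM b) 0 0 = _
  rw [dgM, dgM, Matrix.mul_diagonal, Matrix.diagonal_mul]; rfl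

theorem tri_11 (a b : HH) (g : Sp3) : (dg a * g * dg b).1 1 1 =
    ((a.2.1 : ℂ) : ℍ[ℝ]) * g.1 1 1 * ((b.2.1 : ℂ) : ℍ[ℝ]) := by
  change (dgM a * g.1 * dgM b) 1 1 = _
  rw [dgM, dgM, Matrix.mul_diagonal, Matrix.diagonal_mul]; rfl

theorem tri_22 (a b : HH) (g : Sp3) : (dg a * g * dg b).1 2 2 = a.2.2 * g.1 2 2 * b.2.2 := by
  change (dgM a * g.1 * dgM b) 2 2 = _
  rw [dgM, dgM, Matrix.mul_diagonal, Matrix.diagonal_mul]; rfl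

theorem nz_mul (a b : S3) (w : ℍ[ℝ]) (h : w ≠ 0) : nz (a * w * b) = a * nz w * b := by
  apply Subtype.ext
  have h1 : (a : ℍ[ℝ]) * w * b ≠ 0 := mul_ne_zero (mul_ne_zero (sph_ne_zero a) h) (sph_ne_zero b)
  rw [nz_val h1]
  change _ = (a : ℍ[ℝ]) * (nz w : S3) * b
  rw [nz_val h, norm_mul, norm_mul, sph_norm, sph_norm]
  simp

theorem nzc_mul (a b : Circle) (w : ℍ[ℝ]) (h : cc w ≠ 0) :
    nzc (((a : ℂ) : ℍ[ℝ]) * w * ((b : ℂ) : ℍ[ℝ])) = a * nzc w * b := by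
  apply Subtype.ext
  have h1 : cc (((a : ℂ) : ℍ[ℝ]) * w * ((b : ℂ) : ℍ[ℝ])) ≠ 0 := by
    rw [cc_mul]; simp [h]
  have h2 := nzc_val h1
  have h3 := nzc_val h
  change ((nzc _ : Circle) : ℂ) = (a : ℂ) * (nzc w : Circle) * b
  rw [h2, h3, cc_mul, norm_mul, norm_mul, Circle.norm_coe, Circle.norm_coe]
  simp
  ring

theorem VV_tri (a b : HH) (g : Sp3) (hg : g ∈ VV) : dg a * g * dg b ∈ VV := by
  refine ⟨?_, ?_, ?_⟩
  · rw [tri_00]; exact mul_ne_zero (mul_ne_zero (sph_ne_zero _) hg.1) (sph_ne_zero _)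
  · rw [tri_11, cc_mul]; simp [hg.2.1]
  · rw [tri_22]; exact mul_ne_zero (mul_ne_zero (sph_ne_zero _) hg.2.2) (sph_ne_zero _)

theorem hh_tri (a b : HH) (g : Sp3) (hg : g ∈ VV) : hh (dg a * g * dg b) = a * hh g * b := by
  refine Prod.ext ?_ (Prod.ext ?_ ?_)
  · change nz _ = _; rw [tri_00, nz_mul _ _ _ hg.1]; rfl
  · change nzc _ = _; rw [tri_11, nzc_mul _ _ _ hg.2.1]; rfl
  · change nz _ = _; rw [tri_22, nz_mul _ _ _ hg.2.2]; rfl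

theorem one_VV : (1 : Sp3) ∈ VV := by
  refine ⟨?_, ?_, ?_⟩
  · simp
  · simp only [cc]
    intro h
    have := congrArg Complex.re h
    simp at this
  · simp

theorem hh_one : hh 1 = 1 := by
  have h1 : nz (1 : ℍ[ℝ]) = 1 := by
    apply Subtype.ext; rw [nz_val one_ne_zero]; simp
  have hc : cc 1 = 1 := by apply Complex.ext <;> simp [cc]
  have h2 : nzc 1 = 1 := by
    apply Subtype.ext
    have := nzc_val (w := 1) (by rw [hc]; exact one_ne_zero)
    rw [hc] at this
    simpa using this
  refine Prod.ext ?_ (Prod.ext ?_ ?_)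
  · change nz ((1 : M3) 0 0) = _; rw [Matrix.one_apply_eq, h1]; rfl
  · change nzc ((1 : M3) 1 1) = _; rw [Matrix.one_apply_eq, h2]; rfl
  · change nz ((1 : M3) 2 2) = _; rw [Matrix.one_apply_eq, h1]; rfl

/-- transporter on representatives -/
def tt (g g' : Sp3) : Sp3 := g' * (dg (hh (g⁻¹ * g')))⁻¹ * g⁻¹

theorem tt_wd (g g' : Sp3) (a b : HH) (h : g⁻¹ * g' ∈ VV) : tt (g * dg a) (g' * dg b) = tt g g' := by
  have e : (g * dg a)⁻¹ * (g' * dg b) = dg a⁻¹ * (g⁻¹ * g') * dg b := by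
    rw [map_inv]; group
  rw [tt, e, hh_tri _ _ _ h, tt, map_mul, map_mul, map_inv]
  group

/-- domain on representatives -/
def DD : Set (Q₂ × Q₂) := (Prod.map (Quot.mk H'Rel) (Quot.mk H'Rel)) '' {q | q.1⁻¹ * q.2 ∈ VV}

theorem DD_iff (g g' : Sp3) : ((Quot.mk H'Rel g, Quot.mk H'Rel g') ∈ DD) ↔ g⁻¹ * g' ∈ VV := by
  constructor
  · rintro ⟨⟨u, v⟩, h, e⟩
    simp only [Prod.map, Prod.mk.injEq] at e
    obtain ⟨a, rfl⟩ := (mk_eq_iff _ _).1 e.1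
    obtain ⟨b, rfl⟩ := (mk_eq_iff _ _).1 e.2
    have e : (u * dg a)⁻¹ * (v * dg b) = dg a⁻¹ * (u⁻¹ * v) * dg b := by
      rw [map_inv]; group
    rw [e]
    exact VV_tri _ _ _ h
  · intro h
    exact ⟨(g, g'), h, rfl⟩

/-- transporter on the quotient -/
def TT (x y : Q₂) : Sp3 := tt x.out y.out

theorem TT_mk (g g' : Sp3) (h : g⁻¹ * g' ∈ VV) : TT (Quot.mk _ g) (Quot.mk _ g') = tt g g' := by
  obtain ⟨a, ha⟩ := (mk_eq_iff g (Quot.out (Quot.mk H'Rel g))).1 (Quot.out_eq _).symm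
  obtain ⟨b, hb⟩ := (mk_eq_iff g' (Quot.out (Quot.mk H'Rel g'))).1 (Quot.out_eq _).symm
  rw [TT, ha, hb, tt_wd _ _ _ _ h]

theorem tt_cont : ContinuousOn (fun q : Sp3 × Sp3 => tt q.1 q.2) {q | q.1⁻¹ * q.2 ∈ VV} := by
  unfold tt
  have h1 : Continuous fun q : Sp3 × Sp3 => q.1⁻¹ * q.2 := by fun_prop
  have h2 : ContinuousOn (fun q : Sp3 × Sp3 => dg (hh (q.1⁻¹ * q.2))) {q | q.1⁻¹ * q.2 ∈ VV} :=
    dg_cont.comp_continuousOn (hh_cont.comp h1.continuousOn (fun q hq => hq))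
  have h3 : Continuous fun q : Sp3 × Sp3 => q.1⁻¹ := by fun_prop
  exact (continuous_snd.continuousOn.mul h2.inv).mul h3.continuousOn

theorem dom_open : IsOpen {q : Sp3 × Sp3 | q.1⁻¹ * q.2 ∈ VV} :=
  VV_open.preimage (by fun_prop : Continuous fun q : Sp3 × Sp3 => q.1⁻¹ * q.2)

/-- the fibration over the coset space -/
def fibQ : Fib Sp3 Q₂ HH (Quot.mk H'Rel 1) where
  p := Quot.mk H'Rel
  pc := mk_cont
  p1 := rfl
  τ :=
    { T := TT
      D := DD
      openD := (mk_open.prodMap mk_open).isOpenMap _ dom_open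
      diag := by
        intro x
        induction x using Quot.ind with | mk g =>
        rw [DD_iff]; simpa using one_VV
      cont := by
        rintro ⟨x, y⟩ hxy
        induction x using Quot.ind with | mk g =>
        induction y using Quot.ind with | mk g' =>
        have hv := (DD_iff _ _).1 hxy
        apply ContinuousAt.continuousWithinAt
        have key := (mk_open.prodMap mk_open).continuousAt_comp_iff
          (g := fun q : Q₂ × Q₂ => TT q.1 q.2) (x := (g, g'))
        refine key.1 ?_
        have h1 : ContinuousAt (fun q : Sp3 × Sp3 => tt q.1 q.2) (g, g') :=
          tt_cont.continuousAt (dom_open.mem_nhds hv)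
        refine h1.congr ?_
        filter_upwards [dom_open.mem_nhds hv] with q hq
        exact (TT_mk _ _ hq).symm
      spec := by
        intro x y hxy g hg
        subst hg
        induction y using Quot.ind with | mk g' =>
        rw [TT_mk _ _ ((DD_iff _ _).1 hxy), mk_eq_iff]
        exact ⟨hh (g⁻¹ * g'), by rw [tt]; group⟩
      one := by
        intro x
        induction x using Quot.ind with | mk g =>
        rw [TT_mk _ _ (by simpa using one_VV), tt, inv_mul_cancel, hh_one]
        simp }
  ι := dg
  emb := dg_emb
  fib := mk_eq_iff

end PartJ

section PartK

open unitInterval Topology.Homotopy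

theorem sp1_of (g : Sp3) (h2 : g.1 * prj 2 = prj 2) (h1 : g.1 * prj 1 = prj 1) :
    ∃ q : S3, (q : ℍ[ℝ]) = g.1 0 0 ∧ g = dg (q, 1, 1) := by
  have e10 : g.1 1 0 = 0 := fix_row g 1 0 (by decide) h1
  have e20 : g.1 2 0 = 0 := fix_row g 2 0 (by decide) h2
  have hn : ‖g.1 0 0‖ = 1 := by
    have h := col_ip g 0
    rw [ip, Fin.sum_univ_three] at h
    simp only [e10, e20, mul_zero, add_zero, Quaternion.star_mul_self,
      Quaternion.normSq_eq_norm_mul_self] at h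
    have := congrArg QuaternionAlgebra.re h
    rw [Quaternion.re_coe, Quaternion.re_one, ← sq] at this
    exact (pow_eq_one_iff_of_nonneg (norm_nonneg _) two_ne_zero).1 this
  refine ⟨⟨g.1 0 0, by simpa using hn⟩, rfl, ?_⟩
  apply Subtype.ext
  rw [dg_val, dgM]
  ext1 i j
  fin_cases i <;> fin_cases j
  · rfl
  · exact fix_col g 1 0 (by decide) h1
  · exact fix_col g 2 0 (by decide) h2
  · exact e10
  · rw [map_one]; exact fix_diag g 1 h1
  · exact fix_row g 1 2 (by decide) h1
  · exact e20
  · exact fix_row g 2 1 (by decide) h2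
  · exact fix_diag g 2 h2

theorem dg_prj1 (q : S3) : (dg (q, 1, 1)).1 * prj 1 = prj 1 := by
  rw [dg_val, dgM, prj]
  ext1 i j
  rw [Matrix.diagonal_mul]
  fin_cases i <;> fin_cases j <;> simp [Matrix.single]

theorem dg_prj2 (q : S3) : (dg (q, 1, 1)).1 * prj 2 = prj 2 := by
  rw [dg_val, dgM, prj]
  ext1 i j
  rw [Matrix.diagonal_mul]
  fin_cases i <;> fin_cases j <;> simp [Matrix.single]

theorem i0_cont : Continuous fun q : S3 => ((q, 1, 1) : HH) := by fun_prop

theorem compress {k : ℕ} (hk : k ≤ 4) (f : C(I^ (Fin k), Sp3))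
    (hb : ∀ s ∈ Cube.boundary (Fin k), ∃ q : S3, f s = dg (q, 1, 1)) :
    ∃ a : C(I^ (Fin k), S3), f.HomotopicRel
      (ContinuousMap.mk (fun s => dg (a s, 1, 1)) (dg_cont.comp (i0_cont.comp (map_continuous a))))
      (Cube.boundary (Fin k)) := by
  obtain ⟨f1, h1, -, h12⟩ := stage hk ∅ (by simp) 2 (by simp) f (fun s i hi => absurd hi (by simp))
    (fun s hs => by obtain ⟨q, hq⟩ := hb s hs; rw [hq]; exact dg_prj2 q)
  have e1 : ∀ s ∈ Cube.boundary (Fin k), f1 s = f s := by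
    intro s hs
    obtain ⟨F⟩ := h1
    exact (F.fst_eq_snd hs).symm
  obtain ⟨f2, h2, h22, h21⟩ := stage hk {2} (by simp) 1 (by simp) f1
    (fun s i hi => by rw [Set.mem_singleton_iff] at hi; subst hi; exact h12 s)
    (fun s hs => by obtain ⟨q, hq⟩ := hb s hs; rw [e1 s hs, hq]; exact dg_prj1 q)
  choose a ha ha' using fun s => sp1_of (f2 s) (h22 s 2 rfl) (h21 s)
  have hac : Continuous a := by
    refine Topology.IsInducing.subtypeVal.continuous_iff.2 ?_
    have : (Subtype.val ∘ a) = fun s => (f2 s).1 0 0 := funext ha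
    rw [this]
    exact (ent_cont 0 0).comp (map_continuous f2)
  refine ⟨⟨a, hac⟩, ?_⟩
  have e2 : f2 = ContinuousMap.mk (fun s => dg (a s, 1, 1))
      (dg_cont.comp (i0_cont.comp hac)) := by
    ext1 s; exact ha' s
  have h3 := h1.trans h2
  rw [e2] at h3
  exact h3

/-- first factor loops -/
def j0 {k : ℕ} (a : Ω^ (Fin k) S3 1) : Ω^ (Fin k) HH 1 :=
  mapLoop (fun q : S3 => ((q, 1, 1) : HH)) i0_cont rfl a

theorem sp_surj {k : ℕ} (hk : k ≤ 4) (g : Ω^ (Fin k) Sp3 1) :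
    ∃ a : Ω^ (Fin k) S3 1, GenLoop.Homotopic g (fibQ.incl (j0 a)) := by
  obtain ⟨a, ha⟩ := compress hk g.1 (fun s hs => ⟨1, by
    have := loop_bd g s hs
    refine this.trans ?_
    exact (map_one dg).symm⟩)
  have hb : ∀ s ∈ Cube.boundary (Fin k), a s = 1 := by
    intro s hs
    obtain ⟨F⟩ := ha
    have h1 : g s = dg (a s, 1, 1) := F.fst_eq_snd hs
    rw [loop_bd g s hs, ← map_one dg] at h1
    exact (congrArg Prod.fst (dg_inj h1)).symm
  exact ⟨mkLoop a (map_continuous a) hb, ha⟩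

theorem sp_inj (a : Ω^ (Fin 3) S3 1) (h : GenLoop.Homotopic (fibQ.incl (j0 a)) GenLoop.const) :
    GenLoop.Homotopic a GenLoop.const := by
  obtain ⟨H, hc, h0, h1, hbd⟩ := of_hom h
  have h0 : ∀ s, H s 0 = dg (a s, 1, 1) := h0
  have h1 : ∀ s, H s 1 = dg ((1 : S3), 1, 1) := fun s => (h1 s).trans (map_one dg).symm
  have hbd : ∀ s ∈ Cube.boundary (Fin 3), ∀ t, H s t = dg ((1 : S3), 1, 1) :=
    fun s hs t => (hbd s hs t).trans (map_one dg).symm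
  let f : C(I^ (Fin 4), Sp3) := ⟨fun y => H (Fin.tail y) (y 0),
    hc.comp (continuous_tail.prodMk (continuous_apply 0))⟩
  obtain ⟨b, ⟨F⟩⟩ := compress le_rfl f (by
    intro y hy
    rcases cons_boundary.1 hy with h | h | h
    · exact ⟨a (Fin.tail y), by change H _ _ = _; rw [h, h0]⟩
    · exact ⟨1, by change H _ _ = _; rw [h, h1]⟩
    · exact ⟨1, by change H _ _ = _; rw [hbd _ h]⟩)
  have key : ∀ s t, (t = 0 ∨ t = 1 ∨ s ∈ Cube.boundary (Fin 3)) → ∀ q : S3,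
      H s t = dg (q, 1, 1) → b (Fin.cons t s : I^ (Fin 4)) = q := by
    intro s t hst q hq
    have h2 : f (Fin.cons t s : I^ (Fin 4)) = dg (b (Fin.cons t s : I^ (Fin 4)), 1, 1) :=
      F.fst_eq_snd (cons_boundary'.2 hst)
    have h3 : f (Fin.cons t s : I^ (Fin 4)) = H s t := by
      change H (Fin.tail (Fin.cons t s : I^ (Fin 4))) ((Fin.cons t s : I^ (Fin 4)) 0) = _
      simp
    rw [h3, hq] at h2
    exact (congrArg Prod.fst (dg_inj h2)).symm
  refine hom_of (fun s t => b (Fin.cons t s : I^ (Fin 4))) ((map_continuous b).comp continuous_cons)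
    ?_ ?_ ?_
  · intro s; exact key s 0 (Or.inl rfl) _ (h0 s)
  · intro s; exact key s 1 (Or.inr (Or.inl rfl)) _ (h1 s)
  · intro s hs t; exact key s t (Or.inr (Or.inr hs)) _ (hbd s hs t)

/-- rotation matrices -/
def rtM (t : ℝ) : M3 := !![((Real.cos t : ℝ) : ℍ[ℝ]), 0, ((-Real.sin t : ℝ) : ℍ[ℝ]); 0, 1, 0;
  ((Real.sin t : ℝ) : ℍ[ℝ]), 0, ((Real.cos t : ℝ) : ℍ[ℝ])]

theorem rtM_unitary (t : ℝ) : rtM t ∈ unitary M3 := by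
  have h1 := Real.cos_sq_add_sin_sq t
  constructor
  · ext1 i j
    fin_cases i <;> fin_cases j <;>
      simp only [Matrix.mul_apply, Fin.sum_univ_three, rtM, Matrix.star_eq_conjTranspose] <;>
      simp <;> norm_cast
    · rw [← Quaternion.coe_one]; congr 1; linarith
    · rw [← Quaternion.coe_zero]; congr 1; ring
    · rw [← Quaternion.coe_zero]; congr 1; ring
    · rw [← Quaternion.coe_one]; congr 1; linarith
  · ext1 i j
    fin_cases i <;> fin_cases j <;>
      simp only [Matrix.mul_apply, Fin.sum_univ_three, rtM, Matrix.star_eq_conjTranspose] <;>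
      simp <;> norm_cast
    · rw [← Quaternion.coe_one]; congr 1; linarith
    · rw [← Quaternion.coe_zero]; congr 1; ring
    · rw [← Quaternion.coe_zero]; congr 1; ring
    · rw [← Quaternion.coe_one]; congr 1; linarith

/-- rotations -/
def rt (t : ℝ) : Sp3 := ⟨rtM t, rtM_unitary t⟩

theorem rt_cont : Continuous rt := by
  refine Continuous.subtype_mk ?_ _
  refine continuous_matrix fun i j => ?_
  have h1 := Quaternion.continuous_coe.comp Real.continuous_cos
  have h2 := Quaternion.continuous_coe.comp Real.continuous_sin
  have h3 := Quaternion.continuous_coe.comp Real.continuous_sin.neg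
  fin_cases i <;> fin_cases j
  · exact h1
  · exact continuous_const
  · exact h3
  · exact continuous_const
  · exact continuous_const
  · exact continuous_const
  · exact h2
  · exact continuous_const
  · exact h1

theorem rt_zero : rt 0 = 1 := by
  apply Subtype.ext
  change rtM 0 = 1
  ext1 i j
  fin_cases i <;> fin_cases j <;> simp [rtM]

theorem rt_conj (b : S3) : rt (Real.pi / 2) * dg (b, 1, 1) = dg (1, 1, b) * rt (Real.pi / 2) := by
  apply Subtype.ext
  change rtM _ * dgM _ = dgM _ * rtM _
  rw [dgM, dgM]
  ext1 i j
  rw [Matrix.mul_diagonal, Matrix.diagonal_mul]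
  fin_cases i <;> fin_cases j <;> simp [rtM]

/-- pairs of loops -/
def j2 {k : ℕ} (a b : Ω^ (Fin k) S3 1) : Ω^ (Fin k) HH 1 :=
  mkLoop (fun s => ((a s, 1, b s) : HH))
    ((loop_cont a).prodMk (continuous_const.prodMk (loop_cont b)))
    (fun s hs => by rw [loop_bd a s hs, loop_bd b s hs]; rfl)

/-- products of loops -/
def mulL {k : ℕ} (a b : Ω^ (Fin k) S3 1) : Ω^ (Fin k) S3 1 :=
  mkLoop (fun s => a s * b s) ((loop_cont a).mul (loop_cont b))
    (fun s hs => by rw [loop_bd a s hs, loop_bd b s hs, mul_one])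

/-- inverse of loops -/
def invL {k : ℕ} (a : Ω^ (Fin k) S3 1) : Ω^ (Fin k) S3 1 :=
  mkLoop (fun s => (a s)⁻¹) (loop_cont a).inv
    (fun s hs => by rw [loop_bd a s hs, inv_one])

theorem rot_hom {k : ℕ} (a b : Ω^ (Fin k) S3 1) :
    GenLoop.Homotopic (fibQ.incl (j0 (mulL a b))) (fibQ.incl (j2 a b)) := by
  refine hom_of (fun s t => dg (a s, 1, 1) *
    (rt (Real.pi / 2 * (t : ℝ)) * dg (b s, 1, 1) * (rt (Real.pi / 2 * (t : ℝ)))⁻¹)) ?_ ?_ ?_ ?_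
  · have h1 : Continuous fun q : (I^ (Fin k)) × I => dg (a q.1, 1, 1) :=
      dg_cont.comp (i0_cont.comp ((loop_cont a).comp continuous_fst))
    have h2 : Continuous fun q : (I^ (Fin k)) × I => dg (b q.1, 1, 1) :=
      dg_cont.comp (i0_cont.comp ((loop_cont b).comp continuous_fst))
    have h3 : Continuous fun q : (I^ (Fin k)) × I => rt (Real.pi / 2 * (q.2 : ℝ)) :=
      rt_cont.comp (by fun_prop)
    exact h1.mul ((h3.mul h2).mul h3.inv)
  · intro s
    change _ = dg (a s * b s, 1, 1)
    simp only [Set.Icc.coe_zero, mul_zero, rt_zero, one_mul, inv_one, mul_one]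
    rw [← map_mul]; simp
  · intro s
    change _ = dg (a s, 1, b s)
    simp only [Set.Icc.coe_one, mul_one, rt_conj, mul_inv_cancel_right]
    rw [← map_mul]; simp
  · intro s hs t
    have h1 : dg ((1 : S3), 1, 1) = 1 := map_one dg
    rw [loop_bd a s hs, loop_bd b s hs, h1]; simp

theorem HH_hom {k : ℕ} (f g : Ω^ (Fin k) HH 1)
    (h1 : GenLoop.Homotopic (mapLoop (fun h : HH => h.1) continuous_fst rfl f : Ω^ (Fin k) S3 1)
      (mapLoop (fun h : HH => h.1) continuous_fst rfl g))
    (h2 : GenLoop.Homotopic (mapLoop (fun h : HH => h.2.1) (by fun_prop) rfl f : Ω^ (Fin k) Circle 1)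
      (mapLoop (fun h : HH => h.2.1) (by fun_prop) rfl g))
    (h3 : GenLoop.Homotopic (mapLoop (fun h : HH => h.2.2) (by fun_prop) rfl f : Ω^ (Fin k) S3 1)
      (mapLoop (fun h : HH => h.2.2) (by fun_prop) rfl g)) : GenLoop.Homotopic f g := by
  obtain ⟨A, ac, a0, a1, ab⟩ := of_hom h1
  obtain ⟨B, bc, b0, b1, bb⟩ := of_hom h2
  obtain ⟨C, cc, c0, c1, cb⟩ := of_hom h3
  refine hom_of (fun s t => (A s t, B s t, C s t)) (ac.prodMk (bc.prodMk cc)) ?_ ?_ ?_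
  · intro s; exact Prod.ext (a0 s) (Prod.ext (b0 s) (c0 s))
  · intro s; exact Prod.ext (a1 s) (Prod.ext (b1 s) (c1 s))
  · intro s hs t; exact Prod.ext (ab s hs t) (Prod.ext (bb s hs t) (cb s hs t))

theorem pi2_Q : Nonempty (HomotopyGroup (Fin 2) Q₂ (Quot.mk _ 1) ≃* Multiplicative ℤ) := by
  have hsurj : ∀ g : Ω^ (Fin 2) Sp3 1, ∃ a, GenLoop.Homotopic g (fibQ.incl a) := by
    intro g
    obtain ⟨a, ha⟩ := sp_surj (by norm_num) g
    exact ⟨_, ha⟩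
  have hnull : ∀ a : Ω^ (Fin 1) HH 1, GenLoop.Homotopic (fibQ.incl a) GenLoop.const := by
    intro a
    obtain ⟨b, hb⟩ := sp_surj (k := 1) (by norm_num) (fibQ.incl a)
    refine hb.trans ?_
    have h1 := mapLoop_hom dg dg_cont (map_one dg) (mapLoop_hom (fun q : S3 => ((q, 1, 1) : HH)) i0_cont rfl
      (S3_null (k := 1) (by norm_num) 1 b))
    refine h1.trans ?_
    have : mapLoop dg dg_cont (map_one dg) (mapLoop (fun q : S3 => ((q, 1, 1) : HH)) i0_cont rfl
      (GenLoop.const : Ω^ (Fin 1) S3 1)) = GenLoop.const := by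
      ext1 s; exact map_one dg
    rw [this]
  obtain ⟨e1⟩ := fibQ.equiv_of_null (n := 0) hsurj hnull
  obtain ⟨e2⟩ := pi1_circle 1
  have hc : Continuous fun h : HH => h.2.1 := by fun_prop
  obtain ⟨e3⟩ := mulEquiv_of_map (N := Fin 1) (x := (1 : HH)) (y := (1 : Circle))
    (fun h : HH => h.2.1) hc rfl
    (by
      intro a
      refine ⟨mapLoop (fun z : Circle => ((1, z, 1) : HH)) (by fun_prop) rfl a, ?_⟩
      exact GenLoop.Homotopic.refl _)
    (by
      intro f hf
      refine HH_hom f _ ?_ ?_ ?_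
      · exact (S3_null (k := 1) (by norm_num) 1 _).trans (S3_null (k := 1) (by norm_num) 1 _).symm
      · exact hf
      · exact (S3_null (k := 1) (by norm_num) 1 _).trans (S3_null (k := 1) (by norm_num) 1 _).symm)
  exact ⟨e1.trans (e3.trans e2)⟩

theorem transAt_j2 {k : ℕ} (i : Fin k) (a b : Ω^ (Fin k) S3 1) :
    GenLoop.transAt i (j2 a (invL a)) (j2 b (invL b)) =
      j2 (GenLoop.transAt i a b) (invL (GenLoop.transAt i a b)) := by
  ext1 s
  change _ = ((GenLoop.transAt i a b s, 1, (GenLoop.transAt i a b s)⁻¹) : HH)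
  simp only [transAt_apply]
  split_ifs <;> rfl

theorem pi4_Q : Nonempty (HomotopyGroup (Fin 4) Q₂ (Quot.mk _ 1) ≃* Multiplicative ℤ) := by
  obtain ⟨e⟩ := pi3_S3
  obtain ⟨e1⟩ := mulEquiv_of_rel (N := Fin 4) (M := Fin 3) (X := Q₂) (Y := S3)
    (x := Quot.mk _ 1) (y := 1)
    (fun f a => fibQ.Bd (n := 3) f (j2 a (invL a))) (Fin.succ 0) 0
    (by
      intro f
      obtain ⟨c, hc⟩ := fibQ.bd_total f
      let a : Ω^ (Fin 3) S3 1 := mapLoop (fun h : HH => h.1) continuous_fst rfl c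
      let b : Ω^ (Fin 3) S3 1 := mapLoop (fun h : HH => h.2.2) (by fun_prop) rfl c
      have h1 : GenLoop.Homotopic c (j2 a b) := by
        refine HH_hom _ _ (GenLoop.Homotopic.refl _) ?_ (GenLoop.Homotopic.refl _)
        exact (circle_null (n := 1) _).trans (circle_null (n := 1) _).symm
      have h2 := fibQ.null_of_bd f _ (fibQ.bd_adjust f _ _ hc h1)
      have h3 := sp_inj _ ((rot_hom a b).trans h2)
      refine ⟨a, fibQ.bd_adjust f _ _ hc (h1.trans ?_)⟩
      refine HH_hom _ _ (GenLoop.Homotopic.refl _) (GenLoop.Homotopic.refl _) ?_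
      obtain ⟨A, ac, a0, a1, ab⟩ := of_hom h3
      refine hom_of (fun s t => (a s)⁻¹ * A s t) ?_ ?_ ?_ ?_
      · exact ((loop_cont a).inv.comp continuous_fst).mul ac
      · intro s
        change _ = b s
        rw [a0]
        change (a s)⁻¹ * (a s * b s) = b s
        simp
      · intro s
        change _ = (a s)⁻¹
        rw [a1]
        exact mul_one _
      · intro s hs t
        rw [ab s hs, loop_bd a s hs]; simp)
    (by
      intro a
      refine fibQ.bd_of_null _ ((rot_hom a (invL a)).symm.trans ?_)
      have : fibQ.incl (j0 (mulL a (invL a))) = GenLoop.const := by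
        ext1 s
        change dg (a s * (a s)⁻¹, 1, 1) = 1
        rw [mul_inv_cancel]; exact map_one dg
      rw [this])
    (by
      intro f g a b h1 h2 h
      have := fibQ.bd_fun f g _ _ h1 h2 h
      exact mapLoop_hom (y := (1 : S3)) (fun h : HH => h.1) continuous_fst rfl this)
    (by
      intro f g a b h1 h2
      rw [← transAt_j2]
      exact fibQ.bd_mul 0 f g _ _ h1 h2)
    (by
      intro f a h ha
      refine fibQ.bd_ker ?_ f _ h ?_
      · intro g
        obtain ⟨a, ha⟩ := sp_surj (by norm_num) g
        exact ⟨_, ha⟩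
      · refine HH_hom _ _ ha (GenLoop.Homotopic.refl _) ?_
        have h4 := mapLoop_hom (y := (1 : S3)) (fun q : S3 => q⁻¹) continuous_inv inv_one ha
        refine GenLoop.Homotopic.trans h4 ?_
        have : mapLoop (y := (1 : S3)) (fun q : S3 => q⁻¹) continuous_inv inv_one
          (GenLoop.const : Ω^ (Fin 3) S3 1) = GenLoop.const := by
          ext1 s; exact inv_one
        rw [this]
        exact GenLoop.Homotopic.refl _)
  exact ⟨e1.trans e⟩

theorem mk_mul_rel (g : Sp3) (a b : Sp3) (h : H'Rel a b) : H'Rel (g * a) (g * b) := by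
  obtain ⟨k, hk, rfl⟩ := h
  exact ⟨k, hk, by rw [mul_assoc]⟩

/-- left translation on the quotient -/
def trQ (g : Sp3) : Q₂ ≃ₜ Q₂ where
  toFun := Quot.map (fun a => g * a) (mk_mul_rel g)
  invFun := Quot.map (fun a => g⁻¹ * a) (mk_mul_rel g⁻¹)
  left_inv := by
    intro x
    induction x using Quot.ind with | mk a =>
    simp [Quot.map]
  right_inv := by
    intro x
    induction x using Quot.ind with | mk a =>
    simp [Quot.map]
  continuous_toFun := continuous_quot_lift _ (mk_cont.comp (continuous_const_mul g))
  continuous_invFun := continuous_quot_lift _ (mk_cont.comp (continuous_const_mul g⁻¹))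

theorem trQ_one (g : Sp3) : trQ g (Quot.mk _ 1) = Quot.mk _ g := by
  change Quot.mk _ (g * 1) = _
  rw [mul_one]

end PartK

/-- `π₂(Q₂) ≅ ℤ` and `π₄(Q₂) ≅ ℤ` (for any basepoint). -/
theorem statement13 (x : Q₂) :
    Nonempty ((π_ (1 + 1)) Q₂ x ≃* Multiplicative ℤ) ∧
      Nonempty ((π_ (3 + 1)) Q₂ x ≃* Multiplicative ℤ) := by
  induction x using Quot.ind with | mk g =>
  obtain ⟨e2⟩ := pi2_Q
  obtain ⟨e4⟩ := pi4_Q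
  obtain ⟨t2⟩ := mulEquiv_of_homeo (N := Fin 2) (trQ g) (trQ_one g)
  obtain ⟨t4⟩ := mulEquiv_of_homeo (N := Fin 4) (trQ g) (trQ_one g)
  exact ⟨⟨t2.symm.trans e2⟩, ⟨t4.symm.trans e4⟩⟩
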